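/- (Local Frobenius theorem for metric spaces.) Let X and Y be arc fields on a locally complete metric space M that close, are transverse, and satisfy Conditions E1 and E2, and let F and G be their local flows, regarded as arc fields. Suppose there exist Lipschitz functions a, b : M → ℝ such that [F,G] ∼ aX+bY (locally uniform tangency). Then for every x₀ ∈ M there exists an integral surface S of X and Y through x₀; moreover, for sufficiently small δ > 0 the set S := {F_t(G_s(x₀)) : |s|, |t| < δ} is such an integral surface, and the map (s,t) ↦ F_t(G_s(x₀)) is a homeomorphism from (−δ,δ)² onto S. -/

import Mathlib

open Metric Set Asymptotics

/-- A metric space is *locally complete* if every point has a complete neighborhood. -/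
def LocallyComplete (M : Type*) [MetricSpace M] : Prop :=
  ∀ x : M, ∃ s ∈ nhds x, IsComplete s

variable {M : Type*} [MetricSpace M]

/-- `X : M → ℝ → M` is an *arc field* (only the values for `t ∈ [-1,1]` are relevant):
it is continuous, `X x 0 = x`, each arc `t ↦ X x t` is Lipschitz, and the Lipschitz
constant (the speed `ρ`) is locally bounded. -/
def IsArcField (X : M → ℝ → M) : Prop :=
  ContinuousOn (fun p : M × ℝ => X p.1 p.2) (univ ×ˢ Icc (-1 : ℝ) 1) ∧
  (∀ x, X x 0 = x) ∧
  (∀ x : M, ∃ r > (0 : ℝ), ∃ K > (0 : ℝ), ∀ y ∈ ball x r, ∀ s ∈ Icc (-1 : ℝ) 1,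
      ∀ t ∈ Icc (-1 : ℝ) 1, dist (X y s) (X y t) ≤ K * |s - t|)

/-- Condition E1. -/
def CondE1 (X : M → ℝ → M) : Prop :=
  ∀ x₀ : M, ∃ r > (0 : ℝ), ∃ δ > (0 : ℝ), ∃ Λ > (0 : ℝ),
    ∀ x ∈ ball x₀ r, ∀ y ∈ ball x₀ r, ∀ t : ℝ, |t| < δ →
      dist (X x t) (X y t) ≤ dist x y * (1 + |t| * Λ)

/-- Condition E2. -/
def CondE2 (X : M → ℝ → M) : Prop :=
  ∀ x₀ : M, ∃ r > (0 : ℝ), ∃ δ > (0 : ℝ), ∃ Ω > (0 : ℝ),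
    ∀ x ∈ ball x₀ r, ∀ s t : ℝ, |s| < δ → |t| < δ →
      dist (X x (s + t)) (X (X x s) t) ≤ |s * t| * Ω

/-- Two arc fields *close*: `d(Y_s X_t x, X_t Y_s x) = O(|st|)` locally uniformly. -/
def Close (X Y : M → ℝ → M) : Prop :=
  ∀ x₀ : M, ∃ C > (0 : ℝ), ∃ r > (0 : ℝ), ∃ δ > (0 : ℝ),
    ∀ x ∈ ball x₀ r, ∀ s t : ℝ, |s| < δ → |t| < δ →
      dist (Y (X x t) s) (X (Y x s) t) ≤ C * |s * t|

/-- `σ` is a solution curve of `X` on the open interval `I` (an open order-connected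
set of reals containing `0`) with initial condition `x`. -/
structure IsSolutionCurve (X : M → ℝ → M) (I : Set ℝ) (σ : ℝ → M) (x : M) : Prop where
  isOpen : IsOpen I
  ordConnected : I.OrdConnected
  zero_mem : (0 : ℝ) ∈ I
  init : σ 0 = x
  cont : ContinuousOn σ I
  tangent : ∀ t ∈ I,
    (fun h : ℝ => dist (σ (t + h)) (X (σ t) h)) =o[nhds (0 : ℝ)] fun h => h

/-- The sum of two arc fields: `(X+Y)_t x := Y_t (X_t x)`. -/
def sumArc (X Y : M → ℝ → M) (x : M) (t : ℝ) : M := Y (X x t) t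

/-- The product of a function `a : M → ℝ` with an arc field:
`(aX)(x,t) := X(x, a(x)·t)`, the time truncated to `[-1,1]`. -/
def smulArc (a : M → ℝ) (X : M → ℝ → M) (x : M) (t : ℝ) : M :=
  X x (max (-1) (min 1 (a x * t)))

/-- The bracket of two arc fields. -/
noncomputable def bracket (X Y : M → ℝ → M) (x : M) (t : ℝ) : M :=
  if 0 ≤ t then
    Y (X (Y (X x (Real.sqrt |t|)) (Real.sqrt |t|)) (-Real.sqrt |t|)) (-Real.sqrt |t|)
  else
    X (Y (X (Y x (Real.sqrt |t|)) (Real.sqrt |t|)) (-Real.sqrt |t|)) (-Real.sqrt |t|)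

/-- Local uniform tangency `Z ∼ W` of arc fields: `d(Z_t x, W_t x) = o(t)`
locally uniformly in `x`. -/
def LocUnifTangent (Z W : M → ℝ → M) : Prop :=
  ∀ x₀ : M, ∃ r > (0 : ℝ), ∀ ε > (0 : ℝ), ∃ δ > (0 : ℝ),
    ∀ x ∈ ball x₀ r, ∀ t : ℝ, 0 < |t| → |t| < δ → dist (Z x t) (W x t) ≤ ε * |t|

/-- Transversality of two arc fields. -/
def Transverse (X Y : M → ℝ → M) : Prop :=
  ∀ x₀ : M, ∃ δ > (0 : ℝ), ∀ x ∈ ball x₀ δ, ∀ s t : ℝ, |s| < δ → |t| < δ →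
    δ * (|s| + |t|) ≤ dist (X x s) (Y x t)

/-- A set `S` is locally uniformly tangent to the arc field `Z`:
`d(Z_t x, S) = o(t)` locally uniformly for `x ∈ S`. -/
def SetTangentTo (S : Set M) (Z : M → ℝ → M) : Prop :=
  ∀ x₀ ∈ S, ∃ r > (0 : ℝ), ∀ ε > (0 : ℝ), ∃ δ > (0 : ℝ), ∀ x ∈ S ∩ ball x₀ r,
    ∀ t : ℝ, 0 < |t| → |t| < δ → Metric.infDist (Z x t) S ≤ ε * |t|

/-- `S` is an integral surface of the arc fields `X` and `Y`: a 2-dimensional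
topological manifold locally uniformly tangent to `aX + bY` for all Lipschitz `a b`. -/
def IsIntegralSurface (X Y : M → ℝ → M) (S : Set M) : Prop :=
  Nonempty (ChartedSpace (EuclideanSpace ℝ (Fin 2)) S) ∧
  ∀ a b : M → ℝ, (∃ K, LipschitzWith K a) → (∃ K, LipschitzWith K b) →
    SetTangentTo S (sumArc (smulArc a X) (smulArc b Y))

/-- The bracket of two local flows `F`, `G` (with time domains `IF x`, `IG x`)
is defined at `(x,t)` if all needed times lie in the relevant domains. -/
noncomputable def FlowBracketDefined (F G : M → ℝ → M) (IF IG : M → Set ℝ)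
    (x : M) (t : ℝ) : Prop :=
  if 0 ≤ t then
    Real.sqrt |t| ∈ IF x ∧ Real.sqrt |t| ∈ IG (F x (Real.sqrt |t|)) ∧
      (-Real.sqrt |t|) ∈ IF (G (F x (Real.sqrt |t|)) (Real.sqrt |t|)) ∧
      (-Real.sqrt |t|) ∈ IG (F (G (F x (Real.sqrt |t|)) (Real.sqrt |t|)) (-Real.sqrt |t|))
  else
    Real.sqrt |t| ∈ IG x ∧ Real.sqrt |t| ∈ IF (G x (Real.sqrt |t|)) ∧
      (-Real.sqrt |t|) ∈ IG (F (G x (Real.sqrt |t|)) (Real.sqrt |t|)) ∧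
      (-Real.sqrt |t|) ∈ IF (G (F (G x (Real.sqrt |t|)) (Real.sqrt |t|)) (-Real.sqrt |t|))

/-- Local uniform tangency of the bracket of two local flows to an arc field `W`,
required only where the bracket is defined. -/
noncomputable def FlowBracketTangent (F G : M → ℝ → M) (IF IG : M → Set ℝ)
    (W : M → ℝ → M) : Prop :=
  ∀ x₀ : M, ∃ r > (0 : ℝ), ∀ ε > (0 : ℝ), ∃ δ > (0 : ℝ), ∀ x ∈ ball x₀ r, ∀ t : ℝ,
    0 < |t| → |t| < δ → FlowBracketDefined F G IF IG x t →
      dist (bracket F G x t) (W x t) ≤ ε * |t|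

/-- Linear speed growth of an arc field. -/
def LinearSpeedGrowth (X : M → ℝ → M) : Prop :=
  ∃ x : M, ∃ c₁ > (0 : ℝ), ∃ c₂ > (0 : ℝ), ∀ r > (0 : ℝ), ∀ y ∈ ball x r,
    ∀ s ∈ Icc (-1 : ℝ) 1, ∀ t ∈ Icc (-1 : ℝ) 1,
      dist (X y s) (X y t) ≤ (c₁ * r + c₂) * |s - t|

/-- Iterated sum of a list of arc fields. -/
def comboList : List (M → ℝ → M) → M → ℝ → M
  | [], x, _ => x
  | Z :: L, x, t => comboList L (Z x t) t

/-- The linear combination `a₁X¹ + ⋯ + aₙXⁿ` of arc fields. -/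
def combo {n : ℕ} (X : Fin n → M → ℝ → M) (a : Fin n → M → ℝ) : M → ℝ → M :=
  comboList (List.ofFn fun i => smulArc (a i) (X i))

/-- The distance from `y` to the set of curves through `x` of the linear span
distribution `Δ(X¹,…,Xⁿ)`. -/
noncomputable def distToSpan {n : ℕ} (X : Fin n → M → ℝ → M) (y x : M) : ℝ :=
  sInf {r : ℝ | ∃ (a : Fin n → ℝ) (s : ℝ), s ∈ Icc (-1 : ℝ) 1 ∧
    r = dist y (combo X (fun i _ => a i) x s)}

/-- Local uniform tangency of an arc field to the distribution `Δ(X¹,…,Xⁿ)`. -/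
noncomputable def TangentToSpan {n : ℕ} (Z : M → ℝ → M) (X : Fin n → M → ℝ → M) : Prop :=
  ∀ x₀ : M, ∃ r > (0 : ℝ), ∀ ε > (0 : ℝ), ∃ δ > (0 : ℝ), ∀ x ∈ ball x₀ r, ∀ t : ℝ,
    0 < |t| → |t| < δ → distToSpan X (Z x t) x ≤ ε * |t|

/-- The family `X¹,…,Xⁿ` is transverse: each `Xⁱ` is transverse to the linear span
of the remaining arc fields (encoded by coefficient functions vanishing at slot `i`). -/
def TransverseFamily {n : ℕ} (X : Fin n → M → ℝ → M) : Prop :=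
  ∀ i : Fin n, ∀ x₀ : M, ∃ δ > (0 : ℝ), ∀ x ∈ ball x₀ δ, ∀ a : Fin n → ℝ, a i = 0 →
    ∀ s t : ℝ, |s| < δ → |t| < δ →
      δ * (|s| + |t|) ≤ dist (X i x t) (combo X (fun j _ => a j) x s)

/-- Involutivity of the distribution `Δ(X¹,…,Xⁿ)`. -/
noncomputable def InvolutiveFamily {n : ℕ} (X : Fin n → M → ℝ → M) : Prop :=
  ∀ i j : Fin n, TangentToSpan (bracket (X i) (X j)) X

/-- `S` is an integral surface for the distribution `Δ(X¹,…,Xⁿ)`. -/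
def IsIntegralSurfaceFamily {n : ℕ} (X : Fin n → M → ℝ → M) (S : Set M) : Prop :=
  Nonempty (ChartedSpace (EuclideanSpace ℝ (Fin n)) S) ∧
  ∀ a : Fin n → M → ℝ, (∀ i, ∃ K, LipschitzWith K (a i)) →
    SetTangentTo S (combo X a)

/-- The candidate integral surface `S = {F_t G_s x₀ : |s|,|t| < δ}`. -/
def squareSet {M : Type*} [MetricSpace M] (F G : M → ℝ → M) (x₀ : M) (δ : ℝ) :
    Set M :=
  {y : M | ∃ s t : ℝ, |s| < δ ∧ |t| < δ ∧ y = F (G x₀ s) t}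

section

open Filter Topology

/-! ### Growth estimates along approximate solution curves -/

theorem frequently_slope_lt {f : ℝ → ℝ} {t D : ℝ}
    (h : ∀ ε > (0 : ℝ), ∀ᶠ u in 𝓝[>] (0 : ℝ), f (t + u) ≤ f t + (D + ε) * u) :
    ∀ r, D < r → ∃ᶠ z in 𝓝[>] t, (z - t)⁻¹ * (f z - f t) < r := by
  intro r hr
  apply Eventually.frequently
  have hev := h ((r - D) / 2) (by linarith)
  have htend : Tendsto (fun z => z - t) (𝓝[>] t) (𝓝[>] (0 : ℝ)) := by
    refine tendsto_nhdsWithin_iff.2 ⟨?_, ?_⟩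
    · have : Tendsto (fun z : ℝ => z - t) (𝓝 t) (𝓝 (t - t)) := by
        exact (continuous_id.sub continuous_const).tendsto t
      rw [sub_self] at this
      exact this.mono_left nhdsWithin_le_nhds
    · filter_upwards [self_mem_nhdsWithin] with z hz
      exact sub_pos.2 (mem_Ioi.1 hz)
  filter_upwards [htend.eventually hev, self_mem_nhdsWithin] with z hz hzt
  have hpos : 0 < z - t := sub_pos.2 hzt
  rw [add_sub_cancel] at hz
  rw [inv_mul_lt_iff₀ hpos]
  nlinarith

theorem gronwallBound_le {d K E x : ℝ} (hd : 0 ≤ d) (hK : 0 < K) (hE : 0 ≤ E) (hx : 0 ≤ x)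
    (hKx : K * x ≤ 1 / 2) : gronwallBound d K E x ≤ 2 * d + 2 * E * x := by
  have h0 : 0 ≤ K * x := by positivity
  have h1 : Real.exp (K * x) ≤ 1 + 2 * (K * x) := by
    refine (Real.exp_bound_div_one_sub_of_interval h0 (by linarith)).trans ?_
    rw [div_le_iff₀ (by linarith)]
    nlinarith
  rw [gronwallBound_of_K_ne_0 hK.ne']
  have h2 : E / K * (Real.exp (K * x) - 1) ≤ E / K * (2 * (K * x)) := by
    gcongr
    linarith
  have h3 : E / K * (2 * (K * x)) = 2 * E * x := by field_simp
  have h4 : d * Real.exp (K * x) ≤ d * 2 := by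
    gcongr
    linarith
  simp only
  linarith

/-- `σ` is a forward solution of the arc field `X` on `[0, c]`. -/
structure IsForwardSolution (X : M → ℝ → M) (c : ℝ) (σ : ℝ → M) : Prop where
  cont : ContinuousOn σ (Icc 0 c)
  tangent : ∀ t ∈ Ico 0 c, ∀ ε > (0 : ℝ), ∀ᶠ u in 𝓝[>] (0 : ℝ),
    dist (σ (t + u)) (X (σ t) u) ≤ ε * u

/-- Quantitative control of an arc field on the ball `ball x₀ R` for times less than `δ`. -/
structure ControlledOn (X : M → ℝ → M) (x₀ : M) (R δ K : ℝ) : Prop where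
  delta_pos : 0 < δ
  const_pos : 0 < K
  zero : ∀ x, X x 0 = x
  speed : ∀ x ∈ ball x₀ R, ∀ s t : ℝ, |s| < δ → |t| < δ → dist (X x s) (X x t) ≤ K * |s - t|
  expand : ∀ x ∈ ball x₀ R, ∀ y ∈ ball x₀ R, ∀ t : ℝ, |t| < δ →
    dist (X x t) (X y t) ≤ dist x y * (1 + |t| * K)
  assoc : ∀ x ∈ ball x₀ R, ∀ s t : ℝ, |s| < δ → |t| < δ →
    dist (X x (s + t)) (X (X x s) t) ≤ |s * t| * K
  localSpeed : ∀ x, ∃ C, ∀ t : ℝ, |t| ≤ 1 → dist (X x t) x ≤ C * |t|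

/-- The arc field with time reversed. -/
def timeReverse (X : M → ℝ → M) (x : M) (t : ℝ) : M := X x (-t)

theorem ControlledOn.timeReverse {X : M → ℝ → M} {x₀ : M} {R δ K : ℝ}
    (h : ControlledOn X x₀ R δ K) : ControlledOn (timeReverse X) x₀ R δ K where
  delta_pos := h.delta_pos
  const_pos := h.const_pos
  zero x := by simp [_root_.timeReverse, h.zero]
  speed x hx s t hs ht := by
    have := h.speed x hx (-s) (-t) (by rwa [abs_neg]) (by rwa [abs_neg])
    rwa [neg_sub_neg, abs_sub_comm] at this
  expand x hx y hy t ht := by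
    have := h.expand x hx y hy (-t) (by rwa [abs_neg])
    rwa [abs_neg] at this
  assoc x hx s t hs ht := by
    have := h.assoc x hx (-s) (-t) (by rwa [abs_neg]) (by rwa [abs_neg])
    rwa [neg_mul_neg, ← neg_add] at this
  localSpeed x := by
    obtain ⟨C, hC⟩ := h.localSpeed x
    refine ⟨C, fun t ht => ?_⟩
    have := hC (-t) (by rwa [abs_neg])
    rwa [abs_neg] at this

theorem eventually_lt_nhdsGT_zero {a : ℝ} (ha : 0 < a) : ∀ᶠ u in 𝓝[>] (0 : ℝ), 0 < u ∧ u < a := by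
  filter_upwards [Ioo_mem_nhdsGT ha] with u hu using hu

section Curves

variable {X : M → ℝ → M} {x₀ : M} {R δ K c : ℝ} {σ τ : ℝ → M}

theorem IsForwardSolution.dist_initial_le (h : ControlledOn X x₀ R δ K)
    (hσ : IsForwardSolution X c σ) (hc : dist (σ 0) x₀ + 2 * K * c < R) :
    ∀ t ∈ Icc 0 c, dist (σ t) (σ 0) ≤ 2 * K * t := by
  have hK := h.const_pos
  choose C hC using h.localSpeed
  classical
  set f' : ℝ → ℝ := fun t => if σ t ∈ ball x₀ R then K else C (σ t) with hf'
  refine image_le_of_liminf_slope_right_lt_deriv_boundary' (f' := f') (B' := fun _ => 2 * K)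
    (continuous_dist.comp_continuousOn (hσ.cont.prodMk continuousOn_const)) ?_ ?_ (by fun_prop) ?_ ?_
  · intro t ht
    simp only [slope_def_field, div_eq_inv_mul]
    refine frequently_slope_lt (f := fun t => dist (σ t) (σ 0)) fun ε hε => ?_
    filter_upwards [hσ.tangent t ht ε hε, eventually_lt_nhdsGT_zero (lt_min one_pos h.delta_pos)]
      with u hu hu1
    have hspeed : dist (X (σ t) u) (σ t) ≤ f' t * u := by
      rw [lt_min_iff] at hu1
      simp only [hf']
      split_ifs with hb
      · have := h.speed (σ t) hb u 0 (by rw [abs_of_pos hu1.1]; exact hu1.2.2)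
          (by simpa using h.delta_pos)
        rwa [h.zero, sub_zero, abs_of_pos hu1.1] at this
      · have := hC (σ t) u (by rw [abs_of_pos hu1.1]; exact hu1.2.1.le)
        rwa [abs_of_pos hu1.1] at this
    have := dist_triangle4 (σ (t + u)) (X (σ t) u) (σ t) (σ 0)
    nlinarith
  · simp
  · intro t _
    simpa using ((hasDerivAt_id t).const_mul (2 * K)).hasDerivWithinAt
  · intro t ht heq
    change dist (σ t) (σ 0) = 2 * K * t at heq
    have hb : σ t ∈ ball x₀ R := by
      have h1 := dist_triangle (σ t) (σ 0) x₀
      have h2 : 2 * K * t ≤ 2 * K * c := by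
        have := ht.2.le
        gcongr
      rw [mem_ball]
      linarith
    simp only [hf', if_pos hb]
    linarith

theorem dist_le_of_growth {E : ℝ} (hE : 0 ≤ E) (hK : 0 < K) (hKc : K * c ≤ 1 / 2)
    (hσ : ContinuousOn σ (Icc 0 c)) (hτ : ContinuousOn τ (Icc 0 c))
    (hgrow : ∀ t ∈ Ico 0 c, ∀ ε > (0 : ℝ), ∀ᶠ u in 𝓝[>] (0 : ℝ),
      dist (σ (t + u)) (τ (t + u)) ≤ dist (σ t) (τ t) * (1 + u * K) + (E + ε) * u) :
    ∀ t ∈ Icc 0 c, dist (σ t) (τ t) ≤ 2 * dist (σ 0) (τ 0) + 2 * E * t := by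
  intro t ht
  have hb := le_gronwallBound_of_liminf_deriv_right_le (f := fun t => dist (σ t) (τ t))
    (f' := fun t => K * dist (σ t) (τ t) + E) (δ := dist (σ 0) (τ 0)) (K := K) (ε := E)
    (continuous_dist.comp_continuousOn (hσ.prodMk hτ)) (fun s hs => frequently_slope_lt (f := fun t => dist (σ t) (τ t)) fun ε hε => ?_)
    le_rfl (fun _ _ => le_rfl) t ht
  · rw [sub_zero] at hb
    refine hb.trans (gronwallBound_le dist_nonneg hK hE ht.1 ?_)
    have := ht.2
    nlinarith
  · filter_upwards [hgrow s hs ε hε] with u hu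
    linarith

theorem IsForwardSolution.dist_le (h : ControlledOn X x₀ R δ K)
    (hσ : IsForwardSolution X c σ) (hτ : IsForwardSolution X c τ) (hKc : K * c ≤ 1 / 2)
    (hσR : ∀ t ∈ Icc 0 c, σ t ∈ ball x₀ R) (hτR : ∀ t ∈ Icc 0 c, τ t ∈ ball x₀ R) :
    ∀ t ∈ Icc 0 c, dist (σ t) (τ t) ≤ 2 * dist (σ 0) (τ 0) := by
  intro t ht
  have := dist_le_of_growth le_rfl h.const_pos hKc hσ.cont hτ.cont (fun s hs ε hε => ?_) t ht
  · linarith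
  filter_upwards [hσ.tangent s hs (ε / 2) (by linarith), hτ.tangent s hs (ε / 2) (by linarith),
    eventually_lt_nhdsGT_zero h.delta_pos] with u h1 h2 hu
  have h3 := h.expand (σ s) (hσR s (Ico_subset_Icc_self hs)) (τ s)
    (hτR s (Ico_subset_Icc_self hs)) u (by rw [abs_of_pos hu.1]; exact hu.2)
  rw [abs_of_pos hu.1] at h3
  have h4 := dist_triangle4 (σ (s + u)) (X (σ s) u) (X (τ s) u) (τ (s + u))
  rw [dist_comm (X (τ s) u)] at h4
  linarith

theorem IsForwardSolution.dist_arc_le (h : ControlledOn X x₀ R δ K)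
    (hσ : IsForwardSolution X c σ) (hKc : K * c ≤ 1 / 2) (hc0 : 0 ≤ c) (hcδ : c < δ)
    (hc : dist (σ 0) x₀ + 2 * K * c < R) :
    ∀ t ∈ Icc 0 c, dist (σ t) (X (σ 0) t) ≤ 2 * K * t ^ 2 := by
  intro d hd
  have hK := h.const_pos
  have h0 : σ 0 ∈ ball x₀ R := by
    rw [mem_ball]
    have : 0 ≤ 2 * K * c := by positivity
    linarith
  have hstay := hσ.dist_initial_le h hc
  have hKd : K * d ≤ K * c := by
    have := hd.2
    gcongr
  have hcont : ContinuousOn (X (σ 0)) (Icc 0 d) := by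
    refine (LipschitzOnWith.of_dist_le_mul (K := ⟨K, hK.le⟩) fun s hs t ht => ?_).continuousOn
    rw [Real.dist_eq]
    exact h.speed _ h0 s t (by rw [abs_of_nonneg hs.1]; linarith [hs.2, hd.2])
      (by rw [abs_of_nonneg ht.1]; linarith [ht.2, hd.2])
  have := dist_le_of_growth (σ := σ) (τ := X (σ 0)) (c := d) (E := K * d) (K := K)
    (mul_nonneg hK.le hd.1) hK (by linarith)
    (hσ.cont.mono (Icc_subset_Icc_right hd.2)) hcont (fun s hs ε hε => ?_) d ⟨hd.1, le_rfl⟩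
  · rw [h.zero, dist_self] at this
    nlinarith
  have hsd : s < c := hs.2.trans_le hd.2
  have hKs : 2 * K * s ≤ 2 * K * c := by gcongr
  have hball : σ s ∈ ball x₀ R := by
    have h1 := hstay s ⟨hs.1, hsd.le⟩
    have h2 := dist_triangle (σ s) (σ 0) x₀
    rw [mem_ball]
    linarith
  have hsδ : |s| < δ := by rw [abs_of_nonneg hs.1]; linarith
  have hXball : X (σ 0) s ∈ ball x₀ R := by
    have h1 := h.speed (σ 0) h0 s 0 hsδ (by simpa using h.delta_pos)
    rw [h.zero, sub_zero, abs_of_nonneg hs.1] at h1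
    have h2 := dist_triangle (X (σ 0) s) (σ 0) x₀
    have h3 : 0 ≤ K * s := mul_nonneg hK.le hs.1
    rw [mem_ball]
    linarith
  filter_upwards [hσ.tangent s ⟨hs.1, hsd⟩ ε hε, eventually_lt_nhdsGT_zero h.delta_pos]
    with u h1 hu
  have huδ : |u| < δ := by rw [abs_of_pos hu.1]; exact hu.2
  have h3 := h.expand (σ s) hball (X (σ 0) s) hXball u huδ
  have h5 := h.assoc (σ 0) h0 s u hsδ huδ
  rw [abs_of_pos hu.1] at h3
  rw [abs_of_nonneg (mul_nonneg hs.1 hu.1.le), dist_comm] at h5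
  have h4 := dist_triangle4 (σ (s + u)) (X (σ s) u) (X (X (σ 0) s) u) (X (σ 0) (s + u))
  have h6 : s * u * K ≤ d * u * K := by
    have := hs.2.le
    have := hu.1.le
    gcongr
  nlinarith

end Curves

end

section

open Filter Topology

/-! ### Maximal local flows -/

/-- `F` assigns to each point the maximal solution curve of `X` starting there, with time
domain given by `I`. -/
def IsMaximalFlow (X : M → ℝ → M) (I : M → Set ℝ) (F : M → ℝ → M) : Prop :=
  ∀ x : M, IsSolutionCurve X (I x) (F x) x ∧
    ∀ (J : Set ℝ) (τ : ℝ → M), IsSolutionCurve X J τ x → J ⊆ I x ∧ Set.EqOn τ (F x) J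

section SolutionCurves

variable {X : M → ℝ → M} {I : Set ℝ} {σ : ℝ → M} {x : M}

theorem IsSolutionCurve.shift (h : IsSolutionCurve X I σ x) {s : ℝ} (hs : s ∈ I) :
    IsSolutionCurve X {t | s + t ∈ I} (fun t => σ (s + t)) (σ s) where
  isOpen := h.isOpen.preimage (continuous_const.add continuous_id)
  ordConnected := ⟨fun a ha b hb c hc =>
    h.ordConnected.out ha hb ⟨by linarith [hc.1], by linarith [hc.2]⟩⟩
  zero_mem := by simpa using hs
  init := by simp
  cont := h.cont.comp (continuous_const.add continuous_id).continuousOn fun t ht => ht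
  tangent t ht := by simpa only [add_assoc] using h.tangent (s + t) ht

theorem IsSolutionCurve.timeReverse (h : IsSolutionCurve X I σ x) :
    IsSolutionCurve (timeReverse X) {t | -t ∈ I} (fun t => σ (-t)) x where
  isOpen := h.isOpen.preimage continuous_neg
  ordConnected := ⟨fun a ha b hb c hc =>
    h.ordConnected.out hb ha ⟨by linarith [hc.2], by linarith [hc.1]⟩⟩
  zero_mem := by simpa using h.zero_mem
  init := by simpa using h.init
  cont := h.cont.comp continuous_neg.continuousOn fun t ht => ht
  tangent t ht := by
    have h0 : Tendsto (fun u : ℝ => -u) (𝓝 0) (𝓝 0) := by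
      simpa using (continuous_neg (G := ℝ)).tendsto 0
    have := ((h.tangent (-t) ht).comp_tendsto h0).neg_right
    simpa only [Function.comp_def, neg_add, neg_neg, _root_.timeReverse] using this

theorem IsSolutionCurve.forward (h : IsSolutionCurve X I σ x) {s c : ℝ}
    (hs : ∀ t ∈ Icc 0 c, s + t ∈ I) : IsForwardSolution X c (fun t => σ (s + t)) where
  cont := h.cont.comp (continuous_const.add continuous_id).continuousOn hs
  tangent t ht ε hε := by
    have h1 := (h.tangent (s + t) (hs t (Ico_subset_Icc_self ht))).bound hε
    filter_upwards [nhdsWithin_le_nhds h1, self_mem_nhdsWithin] with u hu hu0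
    rw [Real.norm_eq_abs, Real.norm_eq_abs, abs_of_nonneg dist_nonneg,
      abs_of_pos (mem_Ioi.1 hu0)] at hu
    simpa only [add_assoc] using hu

theorem IsSolutionCurve.forward_zero (h : IsSolutionCurve X I σ x) {c : ℝ}
    (hs : Icc 0 c ⊆ I) : IsForwardSolution X c σ := by
  simpa using h.forward (s := 0) (c := c) (by simpa using fun t h0 h1 => hs ⟨h0, h1⟩)

theorem IsSolutionCurve.congr_of_eventuallyEq {J : Set ℝ} {τ : ℝ → M} (h : IsSolutionCurve X I σ x)
    {t : ℝ} (ht : t ∈ I) (heq : τ =ᶠ[𝓝 t] σ) :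
    ContinuousWithinAt τ J t ∧
      (fun u : ℝ => dist (τ (t + u)) (X (τ t) u)) =o[𝓝 (0 : ℝ)] fun u => u := by
  refine ⟨((h.cont.continuousAt (h.isOpen.mem_nhds ht)).congr heq.symm).continuousWithinAt, ?_⟩
  have h0 : Tendsto (fun u : ℝ => t + u) (𝓝 0) (𝓝 t) := by
    simpa using (show Continuous fun u : ℝ => t + u by fun_prop).tendsto 0
  refine (h.tangent t ht).congr' ?_ EventuallyEq.rfl
  filter_upwards [h0.eventually heq] with u hu
  rw [hu, heq.self_of_nhds]

end SolutionCurves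

theorem timeReverse_timeReverse {N : Type*} (X : N → ℝ → N) : timeReverse (timeReverse X) = X := by
  funext x t
  simp [timeReverse]

theorem IsMaximalFlow.timeReverse {X F : M → ℝ → M} {I : M → Set ℝ} (h : IsMaximalFlow X I F) :
    IsMaximalFlow (timeReverse X) (fun x => {t | -t ∈ I x}) (timeReverse F) := by
  intro x
  refine ⟨(h x).1.timeReverse, fun J τ hτ => ?_⟩
  have hrev := hτ.timeReverse
  rw [timeReverse_timeReverse] at hrev
  obtain ⟨h1, h2⟩ := (h x).2 _ _ hrev
  refine ⟨fun t ht => h1 (by simpa using ht), fun t ht => ?_⟩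
  simpa [_root_.timeReverse] using h2 (x := -t) (by simpa using ht)

theorem IsMaximalFlow.add {X F : M → ℝ → M} {I : M → Set ℝ} (h : IsMaximalFlow X I F) {x : M}
    {s t : ℝ} (hs : s ∈ I x) (hst : s + t ∈ I x) : F (F x s) t = F x (s + t) :=
  (((h (F x s)).2 _ _ ((h x).1.shift hs)).2 hst).symm

theorem ContinuousOn.exists_tendsto_of_dist_le {σ : ℝ → M} {β L : ℝ} {s : Set M}
    (hs : IsComplete s) (hβ : 0 < β) (hL : 0 ≤ L) (hmem : ∀ t ∈ Ico 0 β, σ t ∈ s)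
    (hlip : ∀ t ∈ Ico 0 β, ∀ u ∈ Ico 0 β, t ≤ u → dist (σ u) (σ t) ≤ L * (u - t)) :
    ∃ y, Tendsto σ (𝓝[<] β) (𝓝 y) := by
  have hmemI : Ico 0 β ∈ 𝓝[<] β := Ico_mem_nhdsLT hβ
  have hlip' : LipschitzOnWith ⟨L, hL⟩ σ (Ico 0 β) := by
    refine LipschitzOnWith.of_dist_le_mul fun t ht u hu => ?_
    rw [Real.dist_eq]
    change _ ≤ L * _
    rcases le_total t u with htu | htu
    · rw [dist_comm, abs_sub_comm, abs_of_nonneg (sub_nonneg.2 htu)]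
      exact hlip t ht u hu htu
    · rw [abs_of_nonneg (sub_nonneg.2 htu)]
      exact hlip u hu t ht htu
  have hc : Cauchy (map σ (𝓝[<] β)) :=
    (cauchy_nhds.mono nhdsWithin_le_nhds).map_of_le hlip'.uniformContinuousOn
      (le_principal_iff.2 hmemI)
  obtain ⟨y, -, hy⟩ := hs _ hc (le_principal_iff.2 (mem_map.2 (mem_of_superset hmemI hmem)))
  exact ⟨y, hy⟩

theorem IsMaximalFlow.Icc_subset {X F : M → ℝ → M} {I : M → Set ℝ} {x₀ : M} {R δ K : ℝ}
    (h : IsMaximalFlow X I F) (hX : ControlledOn X x₀ R δ K) {S : Set M} (hS : IsComplete S)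
    (hRS : ball x₀ R ⊆ S) {x : M} {c : ℝ} (hKc : K * c ≤ 1 / 2)
    (hc : dist x x₀ + 2 * K * c < R) : Icc 0 c ⊆ I x := by
  by_contra hcon
  have hK := hX.const_pos
  obtain ⟨hsol, hmax⟩ := h x
  have hne : (Icc 0 c ∩ (I x)ᶜ).Nonempty := by
    obtain ⟨t, ht, ht'⟩ := not_subset.1 hcon
    exact ⟨t, ht, ht'⟩
  obtain ⟨β, ⟨hβc, hβI⟩, hβmin⟩ :=
    (isCompact_Icc.inter_right hsol.isOpen.isClosed_compl).exists_isLeast hne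
  have hβ : 0 < β := by
    rcases hβc.1.eq_or_lt with h0 | h0
    · exact absurd (h0 ▸ hsol.zero_mem) hβI
    · exact h0
  have hIco : ∀ t, 0 ≤ t → t < β → t ∈ I x := by
    intro t h0 ht
    by_contra hn
    exact absurd (hβmin ⟨⟨h0, ht.le.trans hβc.2⟩, hn⟩) (not_le.2 ht)
  have hKβ : 2 * K * β ≤ 2 * K * c := by
    have := hβc.2
    gcongr
  have hdist0 : ∀ t, 0 ≤ t → t < β → dist (F x t) x ≤ 2 * K * t := by
    intro t h0 ht
    have hf : IsForwardSolution X t (F x) :=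
      hsol.forward_zero fun u hu => hIco u hu.1 (hu.2.trans_lt ht)
    have := hf.dist_initial_le hX (by rw [hsol.init]; nlinarith) t ⟨h0, le_rfl⟩
    rwa [hsol.init] at this
  have hlip : ∀ t ∈ Ico 0 β, ∀ u ∈ Ico 0 β, t ≤ u → dist (F x u) (F x t) ≤ 2 * K * (u - t) := by
    intro t ht u hu htu
    have hf : IsForwardSolution X (u - t) (fun v => F x (t + v)) :=
      hsol.forward fun v hv => hIco _ (by linarith [ht.1, hv.1]) (by linarith [hv.2, hu.2])
    have h1 := hdist0 t ht.1 ht.2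
    have h2 := dist_triangle (F x t) x x₀
    have h3 : 2 * K * u ≤ 2 * K * β := by
      have := hu.2.le
      gcongr
    have := hf.dist_initial_le hX (by rw [add_zero]; linarith) (u - t)
      ⟨by linarith, le_rfl⟩
    simpa using this
  have hballF : ∀ t, 0 ≤ t → t < β → F x t ∈ ball x₀ R := by
    intro t h0 ht
    have h1 := hdist0 t h0 ht
    have h2 := dist_triangle (F x t) x x₀
    rw [mem_ball]
    nlinarith
  obtain ⟨y, hy⟩ := ContinuousOn.exists_tendsto_of_dist_le hS hβ (by positivity)
    (fun t ht => hRS (hballF t ht.1 ht.2)) hlip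
  have hyR : y ∈ ball x₀ R := by
    have h1 : dist y x₀ ≤ dist x x₀ + 2 * K * β := by
      refine le_of_tendsto (hy.dist tendsto_const_nhds) ?_
      filter_upwards [Ico_mem_nhdsLT hβ] with t ht
      have h1 := hdist0 t ht.1 ht.2
      have h2 := dist_triangle (F x t) x x₀
      have := ht.2
      nlinarith
    rw [mem_ball]
    linarith
  obtain ⟨hsoly, -⟩ := h y
  obtain ⟨η, hη, hηball⟩ : ∃ η > 0, ∀ t, |t| < η → t ∈ I y ∧ F y t ∈ ball x₀ R := by
    have h1 := hsoly.isOpen.mem_nhds hsoly.zero_mem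
    have h2 : ∀ᶠ t in 𝓝 (0 : ℝ), F y t ∈ ball x₀ R := by
      refine (hsoly.cont.continuousAt h1).eventually_mem (isOpen_ball.mem_nhds ?_)
      rwa [hsoly.init]
    obtain ⟨η, hη, hsub⟩ := Metric.eventually_nhds_iff.1 (h2.and h1)
    exact ⟨η, hη, fun t ht => (hsub (by simpa using ht)).symm⟩
  set η' := min η β with hη'
  have hη'pos : 0 < η' := lt_min hη hβ
  have hback : ∀ s, 0 < s → s < η' → F x (β - s) = F y (-s) := by
    intro s hs hsη
    have hsβ : s < β := hsη.trans_le (min_le_right _ _)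
    have hsη1 : s < η := hsη.trans_le (min_le_left _ _)
    have hyf : IsForwardSolution (_root_.timeReverse X) s (fun t => F y (-t)) :=
      hsoly.timeReverse.forward_zero fun t ht =>
        (hηball (-t) (by rw [abs_neg, abs_of_nonneg ht.1]; linarith [ht.2])).1
    have hlim1 : Tendsto (fun u => dist (F x (u - s)) (F y (-s))) (𝓝[<] β)
        (𝓝 (dist (F x (β - s)) (F y (-s)))) := by
      have hcont : ContinuousAt (F x) (β - s) :=
        hsol.cont.continuousAt (hsol.isOpen.mem_nhds (hIco _ (by linarith) (by linarith)))
      have : Tendsto (fun u => u - s) (𝓝[<] β) (𝓝 (β - s)) :=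
        ((continuous_id.sub continuous_const).tendsto β).mono_left nhdsWithin_le_nhds
      exact (hcont.tendsto.comp this).dist tendsto_const_nhds
    have hlim2 : Tendsto (fun u => 2 * dist (F x u) y) (𝓝[<] β) (𝓝 (2 * dist y y)) :=
      (hy.dist tendsto_const_nhds).const_mul 2
    have hle := le_of_tendsto_of_tendsto hlim1 hlim2 ?_
    · rw [dist_self, mul_zero] at hle
      exact dist_le_zero.1 hle
    filter_upwards [Ioo_mem_nhdsLT hsβ] with u hu
    have hxf : IsForwardSolution (_root_.timeReverse X) s (fun t => F x (-(-u + t))) :=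
      hsol.timeReverse.forward (s := -u) fun t ht =>
        hIco _ (by linarith [ht.2, hu.1]) (by linarith [ht.1, hu.2])
    have := hxf.dist_le hX.timeReverse hyf (by nlinarith [hβc.2])
      (fun t ht => hballF _ (by linarith [ht.2, hu.1]) (by linarith [ht.1, hu.2]))
      (fun t ht => (hηball (-t) (by rw [abs_neg, abs_of_nonneg ht.1]; linarith [ht.2])).2)
      s ⟨hs.le, le_rfl⟩
    simpa [hsoly.init, ← sub_eq_neg_add] using this
  classical
  set τ : ℝ → M := fun t => if t < β then F x t else F y (t - β) with hτ
  have hleft : ∀ t, t < β → τ =ᶠ[𝓝 t] F x := by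
    intro t ht
    filter_upwards [Iio_mem_nhds ht] with u hu
    simp only [hτ, if_pos (mem_Iio.1 hu)]
  have hright : ∀ t, β - η' < t → τ t = F y (t - β) := by
    intro t ht
    by_cases htβ : t < β
    · simp only [hτ, if_pos htβ]
      have := hback (β - t) (by linarith) (by linarith)
      simpa using this
    · simp only [hτ, if_neg htβ]
  have hcurve : ∀ t ∈ Ioo (β - η') (β + η'), ContinuousAt τ t ∧
      (fun u : ℝ => dist (τ (t + u)) (X (τ t) u)) =o[𝓝 (0 : ℝ)] fun u => u := by
    intro t ht
    have htI : t - β ∈ I y := (hηball _ (by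
      rw [abs_lt]
      constructor <;> linarith [ht.1, ht.2, min_le_left η β])).1
    have heq : τ =ᶠ[𝓝 t] fun u => F y (u - β) := by
      filter_upwards [Ioi_mem_nhds ht.1] with u hu using hright u hu
    constructor
    · have hc1 : ContinuousAt (F y) (t - β) := hsoly.cont.continuousAt (hsoly.isOpen.mem_nhds htI)
      have : ContinuousAt (fun u => F y (u - β)) t :=
        ContinuousAt.comp (f := fun u => u - β) hc1 (by fun_prop)
      exact this.congr heq.symm
    · have h0 : Tendsto (fun u : ℝ => t + u) (𝓝 0) (𝓝 t) := by
        simpa using (show Continuous fun u : ℝ => t + u by fun_prop).tendsto 0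
      refine (hsoly.tangent (t - β) htI).congr' ?_ EventuallyEq.rfl
      filter_upwards [h0.eventually heq] with u hu
      rw [hu, heq.self_of_nhds, sub_add_eq_add_sub]
  have hτsol : IsSolutionCurve X ((I x ∩ Iio β) ∪ Ioo (β - η') (β + η')) τ x := by
    have htan : ∀ t ∈ (I x ∩ Iio β) ∪ Ioo (β - η') (β + η'), ContinuousAt τ t ∧
        (fun u : ℝ => dist (τ (t + u)) (X (τ t) u)) =o[𝓝 (0 : ℝ)] fun u => u := by
      rintro t (ht | ht)
      · have := hsol.congr_of_eventuallyEq (J := univ) ht.1 (hleft t ht.2)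
        rwa [continuousWithinAt_univ] at this
      · exact hcurve t ht
    refine ⟨(hsol.isOpen.inter isOpen_Iio).union isOpen_Ioo, ?_, Or.inl ⟨hsol.zero_mem, hβ⟩, ?_,
      fun t ht => (htan t ht).1.continuousWithinAt, fun t ht => (htan t ht).2⟩
    · refine isPreconnected_iff_ordConnected.1 (IsPreconnected.union (β - η' / 2) ?_ ?_ ?_ ?_)
      · exact ⟨hIco _ (by linarith [min_le_right η β]) (by linarith), mem_Iio.2 (by linarith)⟩
      · exact ⟨by linarith, by linarith⟩
      · exact isPreconnected_iff_ordConnected.2 (hsol.ordConnected.inter ordConnected_Iio)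
      · exact isPreconnected_Ioo
    · rw [← hsol.init]
      exact (hleft 0 hβ).self_of_nhds
  exact hβI ((hmax _ _ hτsol).1 (Or.inr ⟨by linarith, by linarith⟩))

end

section

open Filter Topology

theorem exists_controlledOn {X : M → ℝ → M} (hX : IsArcField X) (h1 : CondE1 X)
    (h2 : CondE2 X) (x₀ : M) {ρ : ℝ} (hρ : 0 < ρ) :
    ∃ R, 0 < R ∧ R ≤ ρ ∧ ∃ δ K, ControlledOn X x₀ R δ K := by
  obtain ⟨-, hzero, hspeed⟩ := hX
  obtain ⟨r₀, hr₀, K₀, hK₀, H₀⟩ := hspeed x₀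
  obtain ⟨r₁, hr₁, δ₁, hδ₁, Λ, hΛ, H₁⟩ := h1 x₀
  obtain ⟨r₂, hr₂, δ₂, hδ₂, Ω, hΩ, H₂⟩ := h2 x₀
  refine ⟨min (min r₀ ρ) (min r₁ r₂), by positivity,
    (min_le_left _ _).trans (min_le_right _ _), min 1 (min δ₁ δ₂), K₀ + Λ + Ω, ?_⟩
  refine ⟨by positivity, by positivity, hzero, ?_, ?_, ?_, ?_⟩
  · intro x hx s t hs ht
    rw [lt_min_iff] at hs ht
    refine (H₀ x (ball_subset_ball ((min_le_left _ _).trans (min_le_left _ _)) hx) s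
      (abs_le.1 hs.1.le) t (abs_le.1 ht.1.le)).trans ?_
    gcongr
    linarith
  · intro x hx y hy t ht
    rw [lt_min_iff, lt_min_iff] at ht
    have hsub := (min_le_right (min r₀ ρ) (min r₁ r₂)).trans (min_le_left _ _)
    refine (H₁ x (ball_subset_ball hsub hx) y (ball_subset_ball hsub hy) t ht.2.1).trans ?_
    gcongr
    linarith
  · intro x hx s t hs ht
    rw [lt_min_iff, lt_min_iff] at hs ht
    have hsub := (min_le_right (min r₀ ρ) (min r₁ r₂)).trans (min_le_right _ _)
    refine (H₂ x (ball_subset_ball hsub hx) s t hs.2.2 ht.2.2).trans ?_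
    gcongr
    linarith
  · intro x
    obtain ⟨r, hr, C, hC, H⟩ := hspeed x
    refine ⟨C, fun t ht => ?_⟩
    have := H x (mem_ball_self hr) t (abs_le.1 ht) 0 (by norm_num)
    rwa [hzero, sub_zero] at this

/-- `F` is a flow near `x₀`, with Lipschitz bounds in time and space. -/
structure LocalFlow (F : M → ℝ → M) (x₀ : M) (R T L : ℝ) : Prop where
  radius_pos : 0 < R
  time_pos : 0 < T
  const_pos : 0 < L
  zero : ∀ x, F x 0 = x
  add : ∀ x ∈ ball x₀ R, ∀ s t : ℝ, |s| ≤ T → |s + t| ≤ T → F (F x s) t = F x (s + t)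
  lip_time : ∀ x ∈ ball x₀ R, ∀ s t : ℝ, |s| ≤ T → |t| ≤ T →
    dist (F x s) (F x t) ≤ L * |s - t|
  lip_space : ∀ x ∈ ball x₀ R, ∀ y ∈ ball x₀ R, ∀ t : ℝ, |t| ≤ T →
    dist (F x t) (F y t) ≤ 2 * dist x y

theorem LocalFlow.mono {F : M → ℝ → M} {x₀ : M} {R T L R' T' L' : ℝ}
    (h : LocalFlow F x₀ R T L) (hR' : 0 < R') (hT' : 0 < T') (hR : R' ≤ R) (hT : T' ≤ T)
    (hL : L ≤ L') : LocalFlow F x₀ R' T' L' where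
  radius_pos := hR'
  time_pos := hT'
  const_pos := h.const_pos.trans_le hL
  zero := h.zero
  add x hx s t hs ht := h.add x (ball_subset_ball hR hx) s t (hs.trans hT) (ht.trans hT)
  lip_time x hx s t hs ht :=
    (h.lip_time x (ball_subset_ball hR hx) s t (hs.trans hT) (ht.trans hT)).trans (by gcongr)
  lip_space x hx y hy t ht :=
    h.lip_space x (ball_subset_ball hR hx) y (ball_subset_ball hR hy) t (ht.trans hT)

theorem LocalFlow.timeReverse {F : M → ℝ → M} {x₀ : M} {R T L : ℝ}
    (h : LocalFlow F x₀ R T L) : LocalFlow (timeReverse F) x₀ R T L where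
  radius_pos := h.radius_pos
  time_pos := h.time_pos
  const_pos := h.const_pos
  zero x := by simp [_root_.timeReverse, h.zero]
  add x hx s t hs ht := by
    have := h.add x hx (-s) (-t) (by rwa [abs_neg]) (by rwa [← neg_add, abs_neg])
    simpa only [_root_.timeReverse, neg_add] using this
  lip_time x hx s t hs ht := by
    have := h.lip_time x hx (-s) (-t) (by rwa [abs_neg]) (by rwa [abs_neg])
    rwa [neg_sub_neg, abs_sub_comm] at this
  lip_space x hx y hy t ht := h.lip_space x hx y hy (-t) (by rwa [abs_neg])

/-- Bounds on a maximal flow for nonnegative times. -/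
theorem IsMaximalFlow.forward_bounds {X F : M → ℝ → M} {I : M → Set ℝ} {x₀ : M} {R δ K c : ℝ}
    (h : IsMaximalFlow X I F) (hX : ControlledOn X x₀ R δ K) {S : Set M} (hS : IsComplete S)
    (hRS : ball x₀ R ⊆ S) (hKc : K * c ≤ 1 / 2) (hc0 : 0 ≤ c) (hcδ : c < δ)
    (hcR : 2 * K * c < R / 2) {x : M} (hx : x ∈ ball x₀ (R / 2)) :
    c ∈ I x ∧ dist (F x c) x ≤ 2 * K * c ∧ dist (F x c) (X x c) ≤ 2 * K * c ^ 2 ∧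
      ∀ y ∈ ball x₀ (R / 2), dist (F x c) (F y c) ≤ 2 * dist x y := by
  have hcc : c ∈ Icc 0 c := ⟨hc0, le_rfl⟩
  have hK := hX.const_pos
  have key : ∀ z ∈ ball x₀ (R / 2), Icc 0 c ⊆ I z ∧ IsForwardSolution X c (F z) ∧ F z 0 = z ∧
      dist z x₀ + 2 * K * c < R := by
    intro z hz
    rw [mem_ball] at hz
    have hsub := h.Icc_subset hX hS hRS hKc (by linarith : dist z x₀ + 2 * K * c < R)
    exact ⟨hsub, (h z).1.forward_zero hsub, (h z).1.init, by linarith⟩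
  have stay : ∀ z ∈ ball x₀ (R / 2), ∀ t ∈ Icc 0 c, dist (F z t) z ≤ 2 * K * t := by
    intro z hz t ht
    obtain ⟨-, h2, h3, h4⟩ := key z hz
    have := h2.dist_initial_le hX (by rwa [h3]) t ht
    rwa [h3] at this
  have hball : ∀ z ∈ ball x₀ (R / 2), ∀ t ∈ Icc 0 c, F z t ∈ ball x₀ R := by
    intro z hz t ht
    have h1 := stay z hz t ht
    have h2 := dist_triangle (F z t) z x₀
    have h3 : 2 * K * t ≤ 2 * K * c := by
      have := ht.2
      gcongr
    have h4 := (key z hz).2.2.2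
    rw [mem_ball]
    linarith
  obtain ⟨h1, h2, h3, h4⟩ := key x hx
  refine ⟨h1 hcc, stay x hx c hcc, ?_, fun y hy => ?_⟩
  · have := h2.dist_arc_le hX hKc hc0 hcδ (by rwa [h3]) c hcc
    rwa [h3] at this
  · obtain ⟨-, h2', h3', -⟩ := key y hy
    have := h2.dist_le hX h2' hKc (hball x hx) (hball y hy) c hcc
    rwa [h3, h3'] at this

/-- The maximal flow of a well-behaved arc field on a locally complete space is locally
a Lipschitz flow, is defined for a uniform time, and is second order tangent to the arc field. -/
theorem IsMaximalFlow.exists_localFlow (hM : LocallyComplete M) {X F : M → ℝ → M}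
    {I : M → Set ℝ} (h : IsMaximalFlow X I F) (hX : IsArcField X) (h1 : CondE1 X)
    (h2 : CondE2 X) (x₀ : M) :
    ∃ R T L, LocalFlow F x₀ R T L ∧ (∀ x ∈ ball x₀ R, ∀ t : ℝ, |t| ≤ T → t ∈ I x) ∧
      ∀ x ∈ ball x₀ R, ∀ t : ℝ, |t| ≤ T → dist (F x t) (X x t) ≤ L * t ^ 2 := by
  obtain ⟨S, hSn, hS⟩ := hM x₀
  obtain ⟨ρ, hρ, hρS⟩ := Metric.mem_nhds_iff.1 hSn
  obtain ⟨R, hR, hRρ, δ, K, hc⟩ := exists_controlledOn hX h1 h2 x₀ hρ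
  have hRS : ball x₀ R ⊆ S := (ball_subset_ball hRρ).trans hρS
  have hK := hc.const_pos
  have hδ := hc.delta_pos
  obtain ⟨T, hT, hTδ, hKT, hKTR⟩ : ∃ T > 0, 2 * T < δ ∧ K * T ≤ 1 / 4 ∧ K * T ≤ R / 16 := by
    refine ⟨min (δ / 4) (min (1 / 4 / K) (R / 16 / K)), by positivity, ?_, ?_, ?_⟩
    · have := min_le_left (δ / 4) (min (1 / 4 / K) (R / 16 / K))
      linarith
    · rw [mul_comm, ← le_div_iff₀ hK]
      exact (min_le_right _ _).trans (min_le_left _ _)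
    · rw [mul_comm, ← le_div_iff₀ hK]
      exact (min_le_right _ _).trans (min_le_right _ _)
  have two : ∀ u : ℝ, |u| ≤ 2 * T → ∀ x ∈ ball x₀ (R / 2),
      u ∈ I x ∧ dist (F x u) x ≤ 2 * K * |u| ∧ dist (F x u) (X x u) ≤ 2 * K * u ^ 2 ∧
      ∀ y ∈ ball x₀ (R / 2), dist (F x u) (F y u) ≤ 2 * dist x y := by
    intro u hu x hx
    have hKu : K * |u| ≤ K * (2 * T) := by gcongr
    rcases le_total 0 u with h0 | h0
    · rw [abs_of_nonneg h0] at hu hKu ⊢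
      exact h.forward_bounds hc hS hRS (by linarith) h0 (by linarith) (by linarith) hx
    · rw [abs_of_nonpos h0] at hu hKu ⊢
      have := h.timeReverse.forward_bounds hc.timeReverse hS hRS (c := -u)
        (by linarith) (by linarith) (by linarith) (by linarith) hx
      simpa [_root_.timeReverse] using this
  have hsub : ball x₀ (R / 4) ⊆ ball x₀ (R / 2) := ball_subset_ball (by linarith)
  refine ⟨R / 4, T, 2 * K, ⟨by positivity, hT, by positivity, fun x => (h x).1.init, ?_, ?_, ?_⟩,
    ?_, ?_⟩
  · intro x hx s t hs hst
    exact h.add (two s (by linarith) x (hsub hx)).1 (two (s + t) (by linarith) x (hsub hx)).1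
  · intro x hx s t hs ht
    have hs2 := two s (by linarith) x (hsub hx)
    have hball : F x s ∈ ball x₀ (R / 2) := by
      have h3 := dist_triangle (F x s) x x₀
      have h4 : K * |s| ≤ K * T := by gcongr
      rw [mem_ball] at hx ⊢
      linarith
    have hts : |t - s| ≤ 2 * T := by
      have := abs_sub t s
      linarith
    have hadd : F (F x s) (t - s) = F x t := by
      have := h.add (s := s) (t := t - s) hs2.1
        (by rw [add_sub_cancel]; exact (two t (by linarith) x (hsub hx)).1)
      rwa [add_sub_cancel] at this
    have := (two (t - s) hts _ hball).2.1
    rwa [hadd, dist_comm, abs_sub_comm] at this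
  · intro x hx y hy t ht
    exact (two t (by linarith) x (hsub hx)).2.2.2 y (hsub hy)
  · intro x hx t ht
    exact (two t (by linarith) x (hsub hx)).1
  · intro x hx t ht
    exact (two t (by linarith) x (hsub hx)).2.2.1

end

section

open Filter Topology

/-! ### Infinitesimal exchange of two flows -/

theorem eventually_const_mul_lt (C : ℝ) {c : ℝ} (hc : 0 < c) :
    ∀ᶠ r in 𝓝[>] (0 : ℝ), C * r < c := by
  have h : Tendsto (fun r : ℝ => C * r) (𝓝 0) (𝓝 (C * 0)) :=
    (continuous_const.mul continuous_id).tendsto 0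
  rw [mul_zero] at h
  exact (h.eventually_lt_const hc).filter_mono nhdsWithin_le_nhds

theorem eventually_nhdsGT_zero_iff {P : ℝ → Prop} :
    (∀ᶠ r in 𝓝[>] (0 : ℝ), P r) ↔ ∃ δ > 0, ∀ r, 0 < r → r < δ → P r := by
  constructor
  · intro h
    obtain ⟨δ, hδ, hsub⟩ := mem_nhdsGT_iff_exists_Ioo_subset.1 h
    exact ⟨δ, hδ, fun r h0 h1 => hsub ⟨h0, h1⟩⟩
  · rintro ⟨δ, hδ, h⟩
    filter_upwards [Ioo_mem_nhdsGT hδ] with r hr using h r hr.1 hr.2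

/-- `α` is bounded by `K` and `K`-Lipschitz on `ball x₀ R`. -/
structure BddLipOn (α : M → ℝ) (x₀ : M) (R K : ℝ) : Prop where
  bound : ∀ x ∈ ball x₀ R, |α x| ≤ K
  lip : ∀ x ∈ ball x₀ R, ∀ y ∈ ball x₀ R, |α x - α y| ≤ K * dist x y

namespace BddLipOn

variable {α β : M → ℝ} {x₀ : M} {R K K' : ℝ}

theorem mono {R' : ℝ} (h : BddLipOn α x₀ R K) (hR : R' ≤ R) (hK : K ≤ K') :
    BddLipOn α x₀ R' K' where
  bound x hx := (h.bound x (ball_subset_ball hR hx)).trans hK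
  lip x hx y hy := (h.lip x (ball_subset_ball hR hx) y (ball_subset_ball hR hy)).trans (by gcongr)

theorem neg (h : BddLipOn α x₀ R K) : BddLipOn (fun x => -α x) x₀ R K where
  bound x hx := by simpa using h.bound x hx
  lip x hx y hy := by
    rw [neg_sub_neg, abs_sub_comm]
    exact h.lip x hx y hy

theorem add (h : BddLipOn α x₀ R K) (h' : BddLipOn β x₀ R K') :
    BddLipOn (fun x => α x + β x) x₀ R (K + K') where
  bound x hx := (abs_add_le _ _).trans (add_le_add (h.bound x hx) (h'.bound x hx))
  lip x hx y hy := by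
    have h1 := h.lip x hx y hy
    have h2 := h'.lip x hx y hy
    have h3 := abs_add_le (α x - α y) (β x - β y)
    have h4 : α x + β x - (α y + β y) = α x - α y + (β x - β y) := by ring
    rw [h4]
    linarith

theorem _root_.LipschitzWith.exists_bddLipOn (h : ∃ K, LipschitzWith K α) (x₀ : M) (R : ℝ) :
    ∃ K > 0, BddLipOn α x₀ R K := by
  obtain ⟨K, hK⟩ := h
  have hlip : ∀ x y, |α x - α y| ≤ K * dist x y := fun x y => by
    simpa [Real.dist_eq] using hK.dist_le_mul x y
  refine ⟨|α x₀| + K * |R| + K + 1, by positivity, fun x hx => ?_, fun x _ y _ => ?_⟩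
  · have h1 := hlip x x₀
    have h2 : (K : ℝ) * dist x x₀ ≤ K * |R| := by
      have := (mem_ball.1 hx).le.trans (le_abs_self R)
      gcongr
    have h3 := abs_add_le (α x - α x₀) (α x₀)
    rw [sub_add_cancel] at h3
    have h4 : (0 : ℝ) ≤ K := K.2
    linarith
  · refine (hlip x y).trans ?_
    gcongr
    have : 0 ≤ |α x₀| + K * |R| := by positivity
    linarith

end BddLipOn

theorem LocalFlow.dist_base_le {F : M → ℝ → M} {x₀ : M} {R T L d ρ t : ℝ}
    (h : LocalFlow F x₀ R T L) {x : M} (hx : dist x x₀ ≤ d) (hd : d < R) (ht : |t| ≤ ρ)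
    (hρ : ρ ≤ T) : dist (F x t) x₀ ≤ d + L * ρ := by
  have h1 := h.lip_time x (mem_ball.2 (hx.trans_lt hd)) t 0 (ht.trans hρ)
    (by simpa using h.time_pos.le)
  rw [h.zero, sub_zero] at h1
  have h2 : L * |t| ≤ L * ρ := by
    have := h.const_pos.le
    gcongr
  have h3 := dist_triangle (F x t) x x₀
  linarith

theorem LocalFlow.dist_self_le {F : M → ℝ → M} {x₀ : M} {R T L t : ℝ}
    (h : LocalFlow F x₀ R T L) {x : M} (hx : x ∈ ball x₀ R) (ht : |t| ≤ T) :
    dist (F x t) x ≤ L * |t| := by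
  have h1 := h.lip_time x hx t 0 ht (by simpa using h.time_pos.le)
  rwa [h.zero, sub_zero] at h1

/-- `G_r F_r x` agrees with `F_{r+α(x)r²} G_{r+β(x)r²} F_{γ(x)r²} x` up to `o(r²)`, uniformly
for `x` in the ball. -/
def SwapApprox (F G : M → ℝ → M) (x₀ : M) (R : ℝ) (α β γ : M → ℝ) : Prop :=
  ∀ ε > (0 : ℝ), ∀ᶠ r in 𝓝[>] (0 : ℝ), ∀ x ∈ ball x₀ R,
    dist (G (F x r) r) (F (G (F x (γ x * r ^ 2)) (r + β x * r ^ 2)) (r + α x * r ^ 2)) ≤ ε * r ^ 2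

section Swap

variable {F G : M → ℝ → M} {x₀ : M} {R T L K : ℝ} {α β γ : M → ℝ}

theorem LocalFlow.triple_dist_le (hF : LocalFlow F x₀ R T L) (hG : LocalFlow G x₀ R T L)
    {x : M} {ρ p q w p' q' w' : ℝ} (hx : dist x x₀ + 3 * L * ρ < R) (hρ : ρ ≤ T)
    (hp : |p| ≤ ρ) (hq : |q| ≤ ρ) (hw : |w| ≤ ρ) (hp' : |p'| ≤ ρ) (hq' : |q'| ≤ ρ)
    (hw' : |w'| ≤ ρ) :
    dist (F (G (F x w) q) p) (F (G (F x w') q') p') ≤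
      L * |p - p'| + 2 * L * |q - q'| + 4 * L * |w - w'| := by
  have hL : 0 ≤ L * ρ := mul_nonneg hF.const_pos.le ((abs_nonneg p).trans hp)
  have m0 : x ∈ ball x₀ R := by rw [mem_ball]; linarith
  have m1 : ∀ v, |v| ≤ ρ → dist (F x v) x₀ ≤ dist x x₀ + L * ρ := fun v hv =>
    hF.dist_base_le le_rfl (by linarith) hv hρ
  have m2 : ∀ v y, |v| ≤ ρ → dist y x₀ ≤ dist x x₀ + L * ρ →
      dist (G y v) x₀ ≤ dist x x₀ + L * ρ + L * ρ := fun v y hv hy =>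
    hG.dist_base_le hy (by linarith) hv hρ
  have b1 : ∀ v, |v| ≤ ρ → F x v ∈ ball x₀ R := fun v hv => by
    rw [mem_ball]; linarith [m1 v hv]
  have b2 : ∀ v u, |v| ≤ ρ → |u| ≤ ρ → G (F x v) u ∈ ball x₀ R := fun v u hv hu => by
    rw [mem_ball]; linarith [m2 u _ hu (m1 v hv)]
  have d1 := hF.lip_time x m0 w w' (hw.trans hρ) (hw'.trans hρ)
  have d2 := hG.lip_time _ (b1 w hw) q q' (hq.trans hρ) (hq'.trans hρ)
  have d3 := hG.lip_space _ (b1 w hw) _ (b1 w' hw') q' (hq'.trans hρ)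
  have d4 := hF.lip_time _ (b2 w q hw hq) p p' (hp.trans hρ) (hp'.trans hρ)
  have d5 := hF.lip_space _ (b2 w q hw hq) _ (b2 w' q' hw' hq') p' (hp'.trans hρ)
  have t1 := dist_triangle (G (F x w) q) (G (F x w) q') (G (F x w') q')
  have t2 := dist_triangle (F (G (F x w) q) p) (F (G (F x w) q) p') (F (G (F x w') q') p')
  linarith

theorem abs_mul_sq_le {c K r s : ℝ} (hc : |c| ≤ K) (hs : |r| ≤ s) : |c * r ^ 2| ≤ K * s * s := by
  rw [abs_mul, abs_of_nonneg (sq_nonneg r), ← sq_abs r, sq, mul_assoc]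
  have := (abs_nonneg c).trans hc
  have := (abs_nonneg r).trans hs
  gcongr

/-- The coefficients in `SwapApprox` may be evaluated at a nearby point. -/
theorem SwapApprox.dist_le_of_near (hF : LocalFlow F x₀ R T L) (hG : LocalFlow G x₀ R T L)
    (hα : BddLipOn α x₀ R K) (hβ : BddLipOn β x₀ R K) (hγ : BddLipOn γ x₀ R K) {e r d : ℝ}
    {x u : M} (hx : dist x x₀ + 6 * L * r < R) (hu : u ∈ ball x₀ R) (hr : 0 ≤ r)
    (hKr : K * r ≤ 1) (hrT : 2 * r ≤ T) (hxu : dist x u ≤ d)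
    (h : dist (G (F x r) r)
      (F (G (F x (γ x * r ^ 2)) (r + β x * r ^ 2)) (r + α x * r ^ 2)) ≤ e) :
    dist (G (F x r) r) (F (G (F x (γ u * r ^ 2)) (r + β u * r ^ 2)) (r + α u * r ^ 2)) ≤
      e + 7 * L * K * d * r ^ 2 := by
  have hL := hF.const_pos
  have hLr : 0 ≤ L * r := by positivity
  have hxb : x ∈ ball x₀ R := by rw [mem_ball]; linarith
  have small : ∀ c, |c| ≤ K → |c * r ^ 2| ≤ r := fun c hc => by
    have := abs_mul_sq_le hc (abs_of_nonneg hr).le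
    nlinarith
  have small2 : ∀ c, |c| ≤ K → |r + c * r ^ 2| ≤ 2 * r := fun c hc => by
    have := small c hc
    have := abs_add_le r (c * r ^ 2)
    rw [abs_of_nonneg hr] at this
    linarith
  have diff : ∀ f : M → ℝ, BddLipOn f x₀ R K → |f x * r ^ 2 - f u * r ^ 2| ≤ K * d * r ^ 2 := by
    intro f hf
    rw [← sub_mul, abs_mul, abs_of_nonneg (sq_nonneg r)]
    have h1 := hf.lip x hxb u hu
    have hK : 0 ≤ K := (abs_nonneg _).trans (hf.bound x hxb)
    have h2 : K * dist x u ≤ K * d := by gcongr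
    have := h1.trans h2
    gcongr
  have key := hF.triple_dist_le hG (x := x) (ρ := 2 * r) (by linarith) hrT
    (small2 _ (hα.bound x hxb)) (small2 _ (hβ.bound x hxb))
    ((small _ (hγ.bound x hxb)).trans (by linarith)) (small2 _ (hα.bound u hu))
    (small2 _ (hβ.bound u hu)) ((small _ (hγ.bound u hu)).trans (by linarith))
  rw [add_sub_add_left_eq_sub, add_sub_add_left_eq_sub] at key
  have t1 : L * |α x * r ^ 2 - α u * r ^ 2| ≤ L * (K * d * r ^ 2) := by
    have := diff α hα
    gcongr
  have t2 : L * |β x * r ^ 2 - β u * r ^ 2| ≤ L * (K * d * r ^ 2) := by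
    have := diff β hβ
    gcongr
  have t3 : L * |γ x * r ^ 2 - γ u * r ^ 2| ≤ L * (K * d * r ^ 2) := by
    have := diff γ hγ
    gcongr
  have t4 := dist_triangle (G (F x r) r)
    (F (G (F x (γ x * r ^ 2)) (r + β x * r ^ 2)) (r + α x * r ^ 2))
    (F (G (F x (γ u * r ^ 2)) (r + β u * r ^ 2)) (r + α u * r ^ 2))
  linarith

theorem SwapApprox.reverse_right (hF : LocalFlow F x₀ R T L) (hG : LocalFlow G x₀ R T L)
    (hα : BddLipOn α x₀ R K) (hβ : BddLipOn β x₀ R K) (hγ : BddLipOn γ x₀ R K)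
    (h : SwapApprox F G x₀ R α β γ) :
    SwapApprox F (timeReverse G) x₀ (R / 2) (fun x => -γ x) β (fun x => -α x) := by
  intro ε hε
  have hL := hF.const_pos
  have hR := hF.radius_pos
  filter_upwards [h (ε / 4) (by linarith), self_mem_nhdsWithin, eventually_const_mul_lt K one_pos,
    eventually_const_mul_lt 2 hF.time_pos, eventually_const_mul_lt (32 * L) hR,
    eventually_const_mul_lt (7 * L * K * (4 * L)) (by linarith : 0 < ε / 4)]
    with r hr hr0 hKr hrT hLr hεr u hu
  replace hr0 : 0 < r := hr0
  have hLr0 : 0 < L * r := by positivity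
  have huR : u ∈ ball x₀ R := ball_subset_ball (by linarith) hu
  rw [mem_ball] at hu
  set a := α u * r ^ 2 with ha
  set b := β u * r ^ 2 with hb
  set c := γ u * r ^ 2 with hc
  have small : ∀ k, |k| ≤ K → |k * r ^ 2| ≤ r := fun k hk => by
    have := abs_mul_sq_le hk (abs_of_pos hr0).le
    nlinarith
  have ha' : |a| ≤ r := small _ (hα.bound u huR)
  have hb' : |b| ≤ r := small _ (hβ.bound u huR)
  have hc' : |c| ≤ r := small _ (hγ.bound u huR)
  rw [abs_le] at ha' hb' hc'
  have hrr : |r| ≤ 2 * r := by rw [abs_of_pos hr0]; linarith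
  have hnr : |-r| ≤ 2 * r := by rwa [abs_neg]
  have hab : |-a| ≤ 2 * r := by rw [abs_le]; constructor <;> linarith
  have hbb : |-(r + b)| ≤ 2 * r := by rw [abs_le]; constructor <;> linarith
  have hbb' : |r + b| ≤ 2 * r := by rw [abs_le]; constructor <;> linarith
  have hcb : |-c| ≤ 2 * r := by rw [abs_le]; constructor <;> linarith
  have hraa : |r + a| ≤ 2 * r := by rw [abs_le]; constructor <;> linarith
  have hrcc : |r + -c| ≤ 2 * r := by rw [abs_le]; constructor <;> linarith
  have h2T : 2 * r ≤ T := hrT.le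
  have hT0 : |(0 : ℝ)| ≤ T := by simpa using hF.time_pos.le
  set p₁ := F u (-a) with hp₁
  set p₂ := G p₁ (-(r + b)) with hp₂
  set x := F p₂ (-c) with hxdef
  have m1 : dist p₁ x₀ ≤ R / 2 + L * (2 * r) :=
    hF.dist_base_le hu.le (by linarith) hab h2T
  have m2 : dist p₂ x₀ ≤ R / 2 + L * (2 * r) + L * (2 * r) :=
    hG.dist_base_le m1 (by linarith) hbb h2T
  have m3 : dist x x₀ ≤ R / 2 + L * (2 * r) + L * (2 * r) + L * (2 * r) :=
    hF.dist_base_le m2 (by linarith) hcb h2T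
  have b1 : p₁ ∈ ball x₀ R := by rw [mem_ball]; linarith
  have b2 : p₂ ∈ ball x₀ R := by rw [mem_ball]; linarith
  have b3 : x ∈ ball x₀ R := by rw [mem_ball]; linarith
  have hxu : dist x u ≤ 4 * L * r := by
    have d1 := hF.dist_self_le huR (hab.trans h2T)
    have d2 := hG.dist_self_le b1 (hbb.trans h2T)
    have d3 := hF.dist_self_le b2 (hcb.trans h2T)
    have e1 : L * |-a| ≤ L * r := by
      rw [abs_neg]
      gcongr
      exact abs_le.2 ha'
    have e2 : L * |-(r + b)| ≤ L * (2 * r) := by gcongr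
    have e3 : L * |-c| ≤ L * r := by
      rw [abs_neg]
      gcongr
      exact abs_le.2 hc'
    have := dist_triangle4 x p₂ p₁ u
    linarith
  have key := SwapApprox.dist_le_of_near hF hG hα hβ hγ (by linarith) huR hr0.le hKr.le h2T hxu
    (hr x b3)
  have f1 : F x c = p₂ := by
    rw [hxdef, hF.add p₂ b2 _ _ (hcb.trans h2T) (by simpa using hT0), neg_add_cancel, hF.zero]
  have f2 : G p₂ (r + b) = p₁ := by
    rw [hp₂, hG.add p₁ b1 _ _ (hbb.trans h2T) (by simpa using hT0), neg_add_cancel, hG.zero]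
  have f3 : F p₁ (r + a) = F u r := by
    rw [hp₁, hF.add u huR _ _ (hab.trans h2T) (by simpa using hrr.trans h2T),
      neg_add_cancel_comm_assoc]
  have f4 : F x r = F p₂ (r + -c) := by
    rw [hxdef, hF.add p₂ b2 _ _ (hcb.trans h2T) (by rw [add_comm]; exact hrcc.trans h2T), add_comm]
  rw [← ha, ← hb, ← hc, f1, f2, f3] at key
  have m4 : dist (F x r) x₀ ≤ R / 2 + L * (2 * r) + L * (2 * r) + L * (2 * r) + L * (2 * r) :=
    hF.dist_base_le m3 (by linarith) hrr h2T
  have m5 := hG.dist_base_le m4 (by linarith) hrr h2T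
  have m6 : dist (F u r) x₀ ≤ R / 2 + L * (2 * r) := hF.dist_base_le hu.le (by linarith) hrr h2T
  have f5 : G (G (F x r) r) (-r) = F x r := by
    rw [hG.add _ (by rw [mem_ball]; linarith) _ _ (hrr.trans h2T) (by simpa using hT0),
      add_neg_cancel, hG.zero]
  have d1 := hG.lip_space (G (F x r) r) (by rw [mem_ball]; linarith) (F u r)
    (by rw [mem_ball]; linarith) (-r) (hnr.trans h2T)
  rw [f5, f4, dist_comm] at d1
  have goal_eq : F (timeReverse G (F u (-α u * r ^ 2)) (r + β u * r ^ 2)) (r + -γ u * r ^ 2) =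
      F p₂ (r + -c) := by
    rw [neg_mul, neg_mul, ← ha, ← hb, ← hc]
    rfl
  rw [goal_eq]
  change dist (G (F u r) (-r)) _ ≤ _
  have hr2 : 0 < r ^ 2 := by positivity
  have : 7 * L * K * (4 * L * r) * r ^ 2 ≤ ε / 4 * r ^ 2 := by
    gcongr
    linarith
  rw [f4] at key
  linarith

set_option maxHeartbeats 1000000 in
theorem SwapApprox.reverse_left (hF : LocalFlow F x₀ R T L) (hG : LocalFlow G x₀ R T L)
    (hα : BddLipOn α x₀ R K) (hβ : BddLipOn β x₀ R K) (hγ : BddLipOn γ x₀ R K)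
    (h : SwapApprox F G x₀ R α β γ) :
    SwapApprox (timeReverse F) G x₀ (R / 2) (fun x => α x + -β x) (fun x => -β x)
      (fun x => β x + γ x) := by
  intro ε hε
  have hL := hF.const_pos
  have hR := hF.radius_pos
  have hK : 0 ≤ K := (abs_nonneg _).trans (hα.bound x₀ (mem_ball_self hR))
  obtain ⟨δ, hδ, hswap⟩ := eventually_nhdsGT_zero_iff.1 (h (ε / 9) (by linarith))
  filter_upwards [self_mem_nhdsWithin, eventually_const_mul_lt 2 hδ,
    eventually_const_mul_lt (4 * K) one_pos, eventually_const_mul_lt 4 hF.time_pos,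
    eventually_const_mul_lt (64 * L) hR,
    eventually_const_mul_lt (126 * L ^ 2 * K + 18 * L * K ^ 2) (by linarith : 0 < ε / 2)]
    with ρ hρ0 hρδ hKρ hρT hLρ hερ v hv
  replace hρ0 : 0 < ρ := hρ0
  have hLρ0 : 0 < L * ρ := by positivity
  have hvR : v ∈ ball x₀ R := ball_subset_ball (by linarith) hv
  rw [mem_ball] at hv
  set a := α v with ha
  set b := β v with hb
  set c := γ v with hc
  have ha' : |a| ≤ K := hα.bound v hvR
  have hb' : |b| ≤ K := hβ.bound v hvR
  have hc' : |c| ≤ K := hγ.bound v hvR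
  set r := ρ - b * ρ ^ 2 with hr
  have small : ∀ k, |k| ≤ K → |k * ρ ^ 2| ≤ ρ / 4 := fun k hk => by
    have := abs_mul_sq_le hk (abs_of_pos hρ0).le
    nlinarith
  have hbρ := abs_le.1 (small b hb')
  have hcρ := abs_le.1 (small c hc')
  have haρ := abs_le.1 (small a ha')
  have hr1 : ρ / 2 ≤ r := by linarith
  have hr2 : r ≤ 3 / 2 * ρ := by linarith
  have hr0 : 0 < r := by linarith
  have small' : ∀ k, |k| ≤ K → |k * r ^ 2| ≤ ρ := fun k hk => by
    have := abs_mul_sq_le hk ((abs_of_pos hr0).le.trans hr2)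
    nlinarith
  have hbr := abs_le.1 (small' b hb')
  have hcr := abs_le.1 (small' c hc')
  have har := abs_le.1 (small' a ha')
  have hrρ : |r ^ 2 - ρ ^ 2| ≤ 3 * K * ρ ^ 3 := by
    have h1 : r ^ 2 - ρ ^ 2 = -(b * ρ ^ 2) * (r + ρ) := by rw [hr]; ring
    rw [h1, abs_mul, abs_neg, abs_of_pos (by linarith : 0 < r + ρ)]
    have h2 := abs_mul_sq_le hb' (abs_of_pos hρ0).le
    calc |b * ρ ^ 2| * (r + ρ) ≤ K * ρ * ρ * (3 * ρ) := by
          gcongr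
          linarith
      _ = 3 * K * ρ ^ 3 := by ring
  have diff : ∀ k, |k| ≤ K → |k * (r ^ 2 - ρ ^ 2)| ≤ 3 * K ^ 2 * ρ ^ 3 := fun k hk => by
    rw [abs_mul]
    calc |k| * |r ^ 2 - ρ ^ 2| ≤ K * (3 * K * ρ ^ 3) := by gcongr
      _ = 3 * K ^ 2 * ρ ^ 3 := by ring
  set t₀ := -ρ - c * r ^ 2 with ht₀
  set t₁ := -ρ + r - c * r ^ 2 with ht₁
  have h4T : 4 * ρ ≤ T := hρT.le
  have hT0 : |(0 : ℝ)| ≤ T := by simpa using hF.time_pos.le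
  have bρ : |ρ| ≤ 4 * ρ := by rw [abs_le]; constructor <;> linarith
  have bnρ : |-ρ| ≤ 4 * ρ := by rw [abs_le]; constructor <;> linarith
  have br : |r| ≤ 4 * ρ := by rw [abs_le]; constructor <;> linarith
  have bt₀ : |t₀| ≤ 4 * ρ := by rw [abs_le]; constructor <;> linarith
  have bt₁ : |t₁| ≤ 4 * ρ := by rw [abs_le]; constructor <;> linarith
  have brb : |r + b * r ^ 2| ≤ 4 * ρ := by rw [abs_le]; constructor <;> linarith
  have bra : |r + a * r ^ 2| ≤ 4 * ρ := by rw [abs_le]; constructor <;> linarith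
  have bra' : |-(r + a * r ^ 2)| ≤ 4 * ρ := by rwa [abs_neg]
  set x := F v t₀ with hx
  have m1 : dist x x₀ ≤ R / 2 + L * (4 * ρ) := hF.dist_base_le hv.le (by linarith) bt₀ h4T
  have b1 : x ∈ ball x₀ R := by rw [mem_ball]; linarith
  have hxv : dist x v ≤ 4 * L * ρ := by
    have d1 := hF.dist_self_le hvR (bt₀.trans h4T)
    have : L * |t₀| ≤ L * (4 * ρ) := by gcongr
    linarith
  have hLr : L * r ≤ L * (3 / 2 * ρ) := by gcongr
  have hKr : K * r ≤ K * (3 / 2 * ρ) := by gcongr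
  have key := SwapApprox.dist_le_of_near hF hG hα hβ hγ (by linarith) hvR hr0.le (by linarith)
    (by linarith) hxv (hswap r hr0 (by linarith) x b1)
  have f1 : F x (c * r ^ 2) = F v (-ρ) := by
    rw [hx, hF.add v hvR _ _ (bt₀.trans h4T)
      (by rw [ht₀, sub_add_cancel]; exact bnρ.trans h4T), ht₀, sub_add_cancel]
  have f2 : F x r = F v t₁ := by
    have e : t₀ + r = t₁ := by rw [ht₀, ht₁]; ring
    rw [hx, hF.add v hvR _ _ (bt₀.trans h4T) (by rw [e]; exact bt₁.trans h4T), e]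
  rw [← ha, ← hb, ← hc, f1, f2] at key
  set y := G (F v (-ρ)) (r + b * r ^ 2) with hy
  set z := G (F v t₁) r with hz
  have m2 : dist (F v (-ρ)) x₀ ≤ R / 2 + L * (4 * ρ) :=
    hF.dist_base_le hv.le (by linarith) bnρ h4T
  have m3 : dist y x₀ ≤ R / 2 + L * (4 * ρ) + L * (4 * ρ) :=
    hG.dist_base_le m2 (by linarith) brb h4T
  have m4 : dist (F v t₁) x₀ ≤ R / 2 + L * (4 * ρ) :=
    hF.dist_base_le hv.le (by linarith) bt₁ h4T
  have m5 : dist z x₀ ≤ R / 2 + L * (4 * ρ) + L * (4 * ρ) :=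
    hG.dist_base_le m4 (by linarith) br h4T
  have m6 : dist (F y (r + a * r ^ 2)) x₀ ≤ R / 2 + L * (4 * ρ) + L * (4 * ρ) + L * (4 * ρ) :=
    hF.dist_base_le m3 (by linarith) bra h4T
  have f3 : F (F y (r + a * r ^ 2)) (-(r + a * r ^ 2)) = y := by
    rw [hF.add y (by rw [mem_ball]; linarith) _ _ (bra.trans h4T) (by simpa using hT0),
      add_neg_cancel, hF.zero]
  have d1 := hF.lip_space z (by rw [mem_ball]; linarith) (F y (r + a * r ^ 2))
    (by rw [mem_ball]; linarith) (-(r + a * r ^ 2)) (bra'.trans h4T)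
  rw [f3] at d1
  have d2 := hG.lip_time (F v (-ρ)) (by rw [mem_ball]; linarith) ρ (r + b * r ^ 2)
    (bρ.trans h4T) (brb.trans h4T)
  have e2 : ρ - (r + b * r ^ 2) = -(b * (r ^ 2 - ρ ^ 2)) := by rw [hr]; ring
  rw [e2, abs_neg] at d2
  have d3 := hF.triple_dist_le hG (x := v) (ρ := 4 * ρ) (p := -(r + a * r ^ 2)) (q := r)
    (w := t₁) (p' := -(ρ + (a + -b) * ρ ^ 2)) (q' := ρ + -b * ρ ^ 2) (w' := -((b + c) * ρ ^ 2))
    (by linarith) h4T bra' br bt₁ (by rw [abs_le]; constructor <;> linarith)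
    (by rw [abs_le]; constructor <;> linarith) (by rw [abs_le]; constructor <;> linarith)
  have e3 : -(r + a * r ^ 2) - -(ρ + (a + -b) * ρ ^ 2) = -(a * (r ^ 2 - ρ ^ 2)) := by
    rw [hr]; ring
  have e4 : r - (ρ + -b * ρ ^ 2) = 0 := by rw [hr]; ring
  have e5 : t₁ - -((b + c) * ρ ^ 2) = -(c * (r ^ 2 - ρ ^ 2)) := by rw [ht₁, hr]; ring
  rw [e3, e4, e5, abs_zero, abs_neg, abs_neg] at d3
  have g1 : L * |a * (r ^ 2 - ρ ^ 2)| ≤ L * (3 * K ^ 2 * ρ ^ 3) := by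
    have := diff a ha'
    gcongr
  have g2 : L * |b * (r ^ 2 - ρ ^ 2)| ≤ L * (3 * K ^ 2 * ρ ^ 3) := by
    have := diff b hb'
    gcongr
  have g3 : L * |c * (r ^ 2 - ρ ^ 2)| ≤ L * (3 * K ^ 2 * ρ ^ 3) := by
    have := diff c hc'
    gcongr
  have hrsq : r ^ 2 ≤ 9 / 4 * ρ ^ 2 := by nlinarith
  have g4 : ε / 9 * r ^ 2 + 7 * L * K * (4 * L * ρ) * r ^ 2 ≤
      ε / 9 * (9 / 4 * ρ ^ 2) + 7 * L * K * (4 * L * ρ) * (9 / 4 * ρ ^ 2) := by gcongr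
  have g5 : (126 * L ^ 2 * K + 18 * L * K ^ 2) * ρ * ρ ^ 2 ≤ ε / 2 * ρ ^ 2 := by gcongr
  have t1 := dist_triangle4 (G (F v (-ρ)) ρ) y (F z (-(r + a * r ^ 2)))
    (F (G (F v (-((b + c) * ρ ^ 2))) (ρ + -b * ρ ^ 2)) (-(ρ + (a + -b) * ρ ^ 2)))
  rw [dist_comm y] at t1
  change dist (G (F v (-ρ)) ρ)
    (F (G (F v (-((b + c) * ρ ^ 2))) (ρ + -b * ρ ^ 2)) (-(ρ + (a + -b) * ρ ^ 2))) ≤ ε * ρ ^ 2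
  linarith

end Swap

end

section

open Filter Topology

/-! ### The bracket condition as an exchange relation -/

section Bracket

variable {X Y F G : M → ℝ → M} {x₀ : M} {R T L K : ℝ} {a b : M → ℝ}

theorem smulArc_eq {x : M} {h : ℝ} (hh : |a x * h| ≤ 1) : smulArc a X x h = X x (a x * h) := by
  rw [abs_le] at hh
  rw [smulArc, min_eq_right hh.2, max_eq_right hh.1]

/-- `aX + bY` is second-order close to the composition of the flows. -/
theorem LocalFlow.dist_linComb_le (hF : LocalFlow F x₀ R T L) (hG : LocalFlow G x₀ R T L)
    (hFX : ∀ x ∈ ball x₀ R, ∀ t, |t| ≤ T → dist (F x t) (X x t) ≤ L * t ^ 2)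
    (hGY : ∀ x ∈ ball x₀ R, ∀ t, |t| ≤ T → dist (G x t) (Y x t) ≤ L * t ^ 2)
    (ha : BddLipOn a x₀ R K) (hb : BddLipOn b x₀ R K) {x : M} {h : ℝ}
    (hx : dist x x₀ + 2 * L * K * |h| < R) (h1 : K * |h| ≤ 1) (hT : K * |h| ≤ T) :
    dist (sumArc (smulArc a X) (smulArc b Y) x h) (G (F x (a x * h)) (b x * h)) ≤
      (3 * L * K ^ 2 + 2 * L ^ 2 * K ^ 2) * h ^ 2 := by
  have hL := hF.const_pos
  have hK : 0 ≤ K := (abs_nonneg _).trans (ha.bound x₀ (mem_ball_self hF.radius_pos))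
  have hLK : 0 ≤ L * (K * |h|) := by positivity
  have small : ∀ k, |k| ≤ K → |k * h| ≤ K * |h| := fun k hk => by
    rw [abs_mul]
    gcongr
  have sq : ∀ k, |k| ≤ K → L * (k * h) ^ 2 ≤ L * (K ^ 2 * h ^ 2) := fun k hk => by
    rw [← sq_abs (k * h), ← sq_abs h, ← mul_pow]
    have := small k hk
    gcongr
  have hxR : x ∈ ball x₀ R := by rw [mem_ball]; linarith
  have ha' := ha.bound x hxR
  have hb' := hb.bound x hxR
  have d1 : dist (X x (a x * h)) (F x (a x * h)) ≤ L * (K ^ 2 * h ^ 2) := by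
    rw [dist_comm]
    exact (hFX x hxR _ ((small _ ha').trans hT)).trans (sq _ ha')
  have d1' : L * (K ^ 2 * h ^ 2) ≤ L * (K * |h|) := by
    have : K ^ 2 * h ^ 2 ≤ K * |h| := by
      rw [← sq_abs h, ← mul_pow, pow_two]
      exact mul_le_of_le_one_left (by positivity) h1
    gcongr
  have d2 : dist (F x (a x * h)) x ≤ L * (K * |h|) := by
    refine (hF.dist_self_le hxR ((small _ ha').trans hT)).trans ?_
    have := small _ ha'
    gcongr
  set y := F x (a x * h) with hy
  rw [sumArc, smulArc_eq ((small _ ha').trans h1)]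
  set z := X x (a x * h) with hz
  have hzx : dist z x ≤ 2 * L * K * |h| := by
    have := dist_triangle z y x
    linarith
  have hzR : z ∈ ball x₀ R := by
    have := dist_triangle z x x₀
    rw [mem_ball]
    linarith
  have hyR : y ∈ ball x₀ R := by
    have := dist_triangle y x x₀
    rw [mem_ball]
    linarith
  have hb'' := hb.bound z hzR
  rw [smulArc_eq ((small _ hb'').trans h1)]
  have d3 : dist (Y z (b z * h)) (G z (b z * h)) ≤ L * (K ^ 2 * h ^ 2) := by
    rw [dist_comm]
    exact (hGY z hzR _ ((small _ hb'').trans hT)).trans (sq _ hb'')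
  have d4 := hG.lip_time z hzR (b z * h) (b x * h) ((small _ hb'').trans hT)
    ((small _ hb').trans hT)
  have d5 := hG.lip_space z hzR y hyR (b x * h) ((small _ hb').trans hT)
  have d6 : L * |b z * h - b x * h| ≤ L * (K * (2 * L * K * |h|) * |h|) := by
    rw [← sub_mul, abs_mul]
    have := hb.lip z hzR x hxR
    have : K * dist z x ≤ K * (2 * L * K * |h|) := by gcongr
    have : |b z - b x| ≤ K * (2 * L * K * |h|) := by linarith
    gcongr
  have d7 : L * (K * (2 * L * K * |h|) * |h|) = 2 * L ^ 2 * K ^ 2 * h ^ 2 := by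
    rw [← sq_abs h]
    ring
  have := dist_triangle4 (Y z (b z * h)) (G z (b z * h)) (G z (b x * h)) (G y (b x * h))
  linarith

theorem FlowBracketTangent.swapApprox {IX IY : M → Set ℝ} (hF : LocalFlow F x₀ R T L)
    (hG : LocalFlow G x₀ R T L) (hIX : ∀ x ∈ ball x₀ R, ∀ t, |t| ≤ T → t ∈ IX x)
    (hIY : ∀ x ∈ ball x₀ R, ∀ t, |t| ≤ T → t ∈ IY x)
    (hFX : ∀ x ∈ ball x₀ R, ∀ t, |t| ≤ T → dist (F x t) (X x t) ≤ L * t ^ 2)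
    (hGY : ∀ x ∈ ball x₀ R, ∀ t, |t| ≤ T → dist (G x t) (Y x t) ≤ L * t ^ 2)
    (ha : BddLipOn a x₀ R K) (hb : BddLipOn b x₀ R K)
    (hbr : FlowBracketTangent F G IX IY (sumArc (smulArc a X) (smulArc b Y))) :
    ∃ R' > 0, SwapApprox F G x₀ R' (fun _ => 0) b a := by
  obtain ⟨r₀, hr₀, hbr⟩ := hbr x₀
  have hR := hF.radius_pos
  have hL := hF.const_pos
  have hK : 0 ≤ K := (abs_nonneg _).trans (ha.bound x₀ (mem_ball_self hR))
  refine ⟨min r₀ (R / 2), by positivity, fun ε hε => ?_⟩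
  obtain ⟨δ, hδ, hbr⟩ := hbr (ε / 8) (by linarith)
  filter_upwards [self_mem_nhdsWithin, eventually_const_mul_lt 1 one_pos,
    eventually_const_mul_lt 1 hδ, eventually_const_mul_lt 2 hF.time_pos,
    eventually_const_mul_lt (16 * L) hR, eventually_const_mul_lt K one_pos,
    eventually_const_mul_lt (3 * L * K ^ 2 + 2 * L ^ 2 * K ^ 2) (by linarith : 0 < ε / 8)]
    with r hr0 hr1 hrδ hrT hrL hrK hrε x hx
  replace hr0 : 0 < r := hr0
  rw [one_mul] at hr1 hrδ
  have hLr0 : 0 < L * r := by positivity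
  have hr2 : r ^ 2 ≤ r := by nlinarith
  have habs : |r ^ 2| = r ^ 2 := abs_of_nonneg (sq_nonneg r)
  have hsqrt : Real.sqrt |r ^ 2| = r := by rw [habs, Real.sqrt_sq hr0.le]
  have hx' : dist x x₀ < R / 2 := (mem_ball.1 hx).trans_le (min_le_right _ _)
  have hxR : x ∈ ball x₀ R := by rw [mem_ball]; linarith
  have small : ∀ k, |k| ≤ K → |k * r ^ 2| ≤ r := fun k hk => by
    have := abs_mul_sq_le hk (abs_of_pos hr0).le
    nlinarith
  have ha' := abs_le.1 (small _ (ha.bound x hxR))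
  have hb' := abs_le.1 (small _ (hb.bound x hxR))
  have h2T : 2 * r ≤ T := hrT.le
  have br : |r| ≤ 2 * r := by rw [abs_le]; constructor <;> linarith
  have bnr : |-r| ≤ 2 * r := by rw [abs_le]; constructor <;> linarith
  have bp : |a x * r ^ 2| ≤ 2 * r := by rw [abs_le]; constructor <;> linarith
  have bq : |b x * r ^ 2| ≤ 2 * r := by rw [abs_le]; constructor <;> linarith
  have bqr : |b x * r ^ 2 + r| ≤ 2 * r := by rw [abs_le]; constructor <;> linarith
  have hT0 : |(0 : ℝ)| ≤ T := by simpa using hF.time_pos.le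
  set y₁ := F x r with hy₁
  set y₂ := G y₁ r with hy₂
  set y₃ := F y₂ (-r) with hy₃
  set y₄ := G y₃ (-r) with hy₄
  have m1 : dist y₁ x₀ ≤ R / 2 + L * (2 * r) := hF.dist_base_le hx'.le (by linarith) br h2T
  have m2 : dist y₂ x₀ ≤ R / 2 + L * (2 * r) + L * (2 * r) :=
    hG.dist_base_le m1 (by linarith) br h2T
  have m3 : dist y₃ x₀ ≤ R / 2 + L * (2 * r) + L * (2 * r) + L * (2 * r) :=
    hF.dist_base_le m2 (by linarith) bnr h2T
  have m4 : dist y₄ x₀ ≤ R / 2 + L * (2 * r) + L * (2 * r) + L * (2 * r) + L * (2 * r) :=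
    hG.dist_base_le m3 (by linarith) bnr h2T
  have b1 : y₁ ∈ ball x₀ R := by rw [mem_ball]; linarith
  have b2 : y₂ ∈ ball x₀ R := by rw [mem_ball]; linarith
  have b3 : y₃ ∈ ball x₀ R := by rw [mem_ball]; linarith
  have b4 : y₄ ∈ ball x₀ R := by rw [mem_ball]; linarith
  have hdef : FlowBracketDefined F G IX IY x (r ^ 2) := by
    rw [FlowBracketDefined, if_pos (sq_nonneg r), hsqrt]
    exact ⟨hIX x hxR r (br.trans h2T), hIY _ b1 _ (br.trans h2T), hIX _ b2 _ (bnr.trans h2T),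
      hIY _ b3 _ (bnr.trans h2T)⟩
  have d1 := hbr x (ball_subset_ball (min_le_left _ _) hx) (r ^ 2) (by rw [habs]; positivity)
    (by rw [habs]; linarith) hdef
  rw [bracket, if_pos (sq_nonneg r), hsqrt, habs] at d1
  have hKr2 : K * |r ^ 2| ≤ K * r := by
    rw [habs]
    gcongr
  have hLK : 2 * L * K * |r ^ 2| ≤ 2 * L * r := by
    rw [habs]
    have : K * r * r ≤ 1 * r := by gcongr
    calc 2 * L * K * r ^ 2 = 2 * L * (K * r * r) := by ring
      _ ≤ 2 * L * (1 * r) := by gcongr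
      _ = 2 * L * r := by ring
  have d2 := hF.dist_linComb_le hG hFX hGY ha hb (x := x) (h := r ^ 2) (by linarith)
    (hKr2.trans hrK.le) (by
      have : K * |r ^ 2| ≤ r := by
        rw [habs]
        nlinarith
      linarith)
  set p := F x (a x * r ^ 2) with hp
  set w := G p (b x * r ^ 2) with hw
  have n1 : dist p x₀ ≤ R / 2 + L * (2 * r) := hF.dist_base_le hx'.le (by linarith) bp h2T
  have n2 : dist w x₀ ≤ R / 2 + L * (2 * r) + L * (2 * r) :=
    hG.dist_base_le n1 (by linarith) bq h2T
  have n3 : dist (G w r) x₀ ≤ R / 2 + L * (2 * r) + L * (2 * r) + L * (2 * r) :=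
    hG.dist_base_le n2 (by linarith) br h2T
  have d3 := hG.lip_space y₄ b4 w (by rw [mem_ball]; linarith) r (br.trans h2T)
  have f1 : G y₄ r = y₃ := by
    rw [hy₄, hG.add _ b3 _ _ (bnr.trans h2T) (by simpa using hT0), neg_add_cancel, hG.zero]
  have f2 : F y₃ r = y₂ := by
    rw [hy₃, hF.add _ b2 _ _ (bnr.trans h2T) (by simpa using hT0), neg_add_cancel, hF.zero]
  have d4 := hF.lip_space (G y₄ r) (by rwa [f1]) (G w r) (by rw [mem_ball]; linarith) r
    (br.trans h2T)
  have f3 : G w r = G p (r + b x * r ^ 2) := by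
    rw [hw, hG.add p (by rw [mem_ball]; linarith) _ _ (bq.trans h2T) (bqr.trans h2T), add_comm]
  rw [f1, f2, f3] at d4
  rw [f1, f3] at d3
  rw [zero_mul, add_zero]
  have d5 : (3 * L * K ^ 2 + 2 * L ^ 2 * K ^ 2) * (r ^ 2) ^ 2 ≤ ε / 8 * r ^ 2 := by
    have : (3 * L * K ^ 2 + 2 * L ^ 2 * K ^ 2) * r ^ 2 ≤ ε / 8 := by
      refine le_trans ?_ hrε.le
      gcongr
    rw [pow_two (r ^ 2), ← mul_assoc]
    gcongr
  have := dist_triangle y₄ (sumArc (smulArc a X) (smulArc b Y) x (r ^ 2)) w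
  linarith

end Bracket

end

section

open Filter Topology

/-! ### Transport of one flow along the other -/

section Transport

variable {F G : M → ℝ → M} {x₀ : M} {R T L A C : ℝ} {α β γ : M → ℝ}

/-- The flows exchange up to a quadratic error. -/
def QuadClose (F G : M → ℝ → M) (x₀ : M) (R T C : ℝ) : Prop :=
  ∀ x ∈ ball x₀ R, ∀ s t, |s| ≤ T → |t| ≤ T →
    dist (G (F x t) s) (F (G x s) t) ≤ C * (|s| + |t|) ^ 2

theorem QuadClose.mono {R' T' : ℝ} (h : QuadClose F G x₀ R T C) (hR : R' ≤ R) (hT : T' ≤ T) :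
    QuadClose F G x₀ R' T' C := fun x hx s t hs ht =>
  h x (ball_subset_ball hR hx) s t (hs.trans hT) (ht.trans hT)

theorem QuadClose.reverse_left (h : QuadClose F G x₀ R T C) :
    QuadClose (timeReverse F) G x₀ R T C := fun x hx s t hs ht => by
  simpa [timeReverse] using h x hx s (-t) hs (by rwa [abs_neg])

theorem QuadClose.reverse_right (h : QuadClose F G x₀ R T C) :
    QuadClose F (timeReverse G) x₀ R T C := fun x hx s t hs ht => by
  simpa [timeReverse] using h x hx (-s) t (by rwa [abs_neg]) ht

set_option maxHeartbeats 1000000 in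
theorem SwapApprox.transport_step (hF : LocalFlow F x₀ R T L) (hG : LocalFlow G x₀ R T L)
    (hα : ∀ x ∈ ball x₀ R, |α x| ≤ A) (hβ : ∀ x ∈ ball x₀ R, |β x| ≤ A)
    (hγ : ∀ x ∈ ball x₀ R, |γ x| ≤ A) (hcl : QuadClose F G x₀ R T C) (hC : 0 ≤ C) {ε s t₀ : ℝ}
    (hs : 0 < s) (hst₀ : s ≤ t₀) (hAt₀ : 8 * A * t₀ ≤ 1) (ht₀T : 8 * t₀ ≤ T)
    (ht₀R : 32 * L * t₀ ≤ R) (hε : 0 ≤ ε)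
    (hswap : ∀ r, 0 < r → r ≤ 2 * s → ∀ x ∈ ball x₀ R,
      dist (G (F x r) r) (F (G (F x (γ x * r ^ 2)) (r + β x * r ^ 2)) (r + α x * r ^ 2)) ≤
        ε * r ^ 2)
    {z : M} (hz : z ∈ ball x₀ (R / 2)) (n : ℕ) :
    ∀ τ t r, 0 ≤ t → t ≤ n * (s / 4) → t ≤ t₀ → |r - s| ≤ 4 * A * s * (t₀ - t) →
      |τ + t| ≤ t₀ + 8 * A * s * (t₀ - t) →
      ∃ t' s', |t' - (τ + t)| ≤ 8 * A * s * t ∧ |s'| ≤ 2 * s ∧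
        dist (F (G (F z t) r) τ) (F (G z s') t') ≤ 8 * ε * s * t + 72 * C * s ^ 2 := by
  have hL := hF.const_pos
  have hR := hF.radius_pos
  have hA : 0 ≤ A := (abs_nonneg _).trans (hα x₀ (mem_ball_self hR))
  have hzR : z ∈ ball x₀ R := ball_subset_ball (by linarith) hz
  rw [mem_ball] at hz
  have ht₀ : 0 < t₀ := hs.trans_le hst₀
  have hLt₀ : 0 < L * t₀ := by positivity
  have hAs : 8 * A * s ≤ 1 := le_trans (by gcongr) hAt₀
  have hT0 : |(0 : ℝ)| ≤ T := by simpa using hF.time_pos.le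
  have r_bounds : ∀ t r, 0 ≤ t → |r - s| ≤ 4 * A * s * (t₀ - t) →
      s / 2 ≤ r ∧ r ≤ 3 / 2 * s := by
    intro t r ht hr
    have h1 : 4 * A * s * (t₀ - t) ≤ 4 * A * s * t₀ := by
      gcongr
      linarith
    have h2 : 8 * A * t₀ * s ≤ 1 * s := by gcongr
    have := abs_le.1 hr
    constructor <;> linarith
  have τ_bounds : ∀ t τ, 0 ≤ t → t ≤ t₀ → |τ + t| ≤ t₀ + 8 * A * s * (t₀ - t) →
      |τ| ≤ 3 * t₀ := by
    intro t τ ht htt₀ hτ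
    have h1 : 8 * A * s * (t₀ - t) ≤ 1 * (t₀ - t) :=
      mul_le_mul_of_nonneg_right hAs (by linarith)
    have := abs_le.1 hτ
    rw [abs_le]
    constructor <;> linarith
  have base : ∀ τ t r, 0 ≤ t → t ≤ t₀ → |r - s| ≤ 4 * A * s * (t₀ - t) →
      |τ + t| ≤ t₀ + 8 * A * s * (t₀ - t) → t ≤ 2 * r →
      ∃ t' s', |t' - (τ + t)| ≤ 8 * A * s * t ∧ |s'| ≤ 2 * s ∧
        dist (F (G (F z t) r) τ) (F (G z s') t') ≤ 8 * ε * s * t + 72 * C * s ^ 2 := by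
    intro τ t r ht htt₀ hr hτ htr
    obtain ⟨hr1, hr2⟩ := r_bounds t r ht hr
    have hτ' := τ_bounds t τ ht htt₀ hτ
    have at' : |t| ≤ t₀ := by rwa [abs_of_nonneg ht]
    have ar : |r| ≤ 2 * t₀ := by rw [abs_of_nonneg (by linarith)]; linarith
    have aτt : |t + τ| ≤ 4 * t₀ := (abs_add_le _ _).trans (by linarith)
    refine ⟨τ + t, r, by simp only [sub_self, abs_zero]; positivity,
      by rw [abs_of_nonneg (by linarith)]; linarith, ?_⟩
    have m1 : dist (F z t) x₀ ≤ R / 2 + L * t₀ :=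
      hF.dist_base_le hz.le (by linarith) at' (by linarith)
    have m2 : dist (G (F z t) r) x₀ ≤ R / 2 + L * t₀ + L * (2 * t₀) :=
      hG.dist_base_le m1 (by linarith) ar (by linarith)
    have m3 : dist (G z r) x₀ ≤ R / 2 + L * (2 * t₀) :=
      hG.dist_base_le hz.le (by linarith) ar (by linarith)
    have m4 : dist (F (G z r) t) x₀ ≤ R / 2 + L * (2 * t₀) + L * t₀ :=
      hF.dist_base_le m3 (by linarith) at' (by linarith)
    have d1 := hF.lip_space (G (F z t) r) (by rw [mem_ball]; linarith) (F (G z r) t)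
      (by rw [mem_ball]; linarith) τ (by linarith)
    rw [hF.add (G z r) (by rw [mem_ball]; linarith) t τ (by linarith) (by linarith),
      add_comm t τ] at d1
    have d2 := hcl z hzR r t (by linarith) (by linarith)
    rw [abs_of_nonneg ht, abs_of_nonneg (by linarith : 0 ≤ r)] at d2
    have d3 : C * (r + t) ^ 2 ≤ C * (6 * s) ^ 2 := by
      gcongr <;> linarith
    have : 0 ≤ 8 * ε * s * t := by positivity
    linarith
  induction n with
  | zero =>
    intro τ t r ht htn htt₀ hr hτ
    refine base τ t r ht htt₀ hr hτ ?_
    have := r_bounds t r ht hr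
    rw [Nat.cast_zero, zero_mul] at htn
    linarith
  | succ n ih =>
    intro τ t r ht htn htt₀ hr hτ
    rcases le_or_gt t (2 * r) with htr | htr
    · exact base τ t r ht htt₀ hr hτ htr
    obtain ⟨hr1, hr2⟩ := r_bounds t r ht hr
    have hr0 : 0 < r := by linarith
    have small : ∀ k, |k| ≤ A → |k * r ^ 2| ≤ r / 4 := fun k hk => by
      have h1 := abs_mul_sq_le hk (abs_of_pos hr0).le
      have h2 : A * r ≤ 1 / 4 := by
        have : A * r ≤ A * (3 / 2 * s) := by gcongr
        linarith
      have h3 : A * r * r ≤ 1 / 4 * r := by gcongr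
      linarith
    set x := F z (t - r) with hx
    have atr : |t - r| ≤ t₀ := by rw [abs_le]; constructor <;> linarith
    have m0 : dist x x₀ ≤ R / 2 + L * t₀ :=
      hF.dist_base_le hz.le (by linarith) atr (by linarith)
    have hxR : x ∈ ball x₀ R := by rw [mem_ball]; linarith
    have ha := hα x hxR
    have hb := hβ x hxR
    have hc := hγ x hxR
    set a := α x with ha_def
    set b := β x with hb_def
    set c := γ x with hc_def
    have har := abs_le.1 (small a ha)
    have hbr := abs_le.1 (small b hb)
    have hcr := abs_le.1 (small c hc)
    set t₁ := t - r + c * r ^ 2 with ht₁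
    set r₁ := r + b * r ^ 2 with hr₁
    set τ₁ := r + a * r ^ 2 + τ with hτ₁
    have ht₁0 : 0 ≤ t₁ := by linarith
    have hstep : r / 2 ≤ t - t₁ := by linarith
    have hr_sq : r ^ 2 ≤ 4 * s * (t - t₁) := by nlinarith
    have bnd : ∀ k, |k| ≤ A → |k * r ^ 2| ≤ A * (4 * s * (t - t₁)) := fun k hk => by
      rw [abs_mul, abs_of_nonneg (sq_nonneg r)]
      gcongr
    have hτ'r : |r₁ - s| ≤ 4 * A * s * (t₀ - t₁) := by
      have h1 : r₁ - s = (r - s) + b * r ^ 2 := by rw [hr₁]; ring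
      rw [h1]
      have := (abs_add_le (r - s) (b * r ^ 2)).trans (add_le_add hr (bnd b hb))
      linarith
    have hdiff : |τ₁ + t₁ - (τ + t)| ≤ 8 * A * s * (t - t₁) := by
      have h1 : τ₁ + t₁ - (τ + t) = a * r ^ 2 + c * r ^ 2 := by rw [hτ₁, ht₁]; ring
      rw [h1]
      have := (abs_add_le (a * r ^ 2) (c * r ^ 2)).trans (add_le_add (bnd a ha) (bnd c hc))
      linarith
    have hτt : |τ₁ + t₁| ≤ t₀ + 8 * A * s * (t₀ - t₁) := by
      have h1 := abs_add_le (τ₁ + t₁ - (τ + t)) (τ + t)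
      rw [sub_add_cancel] at h1
      linarith
    have ht₁t₀ : t₁ ≤ t₀ := by linarith
    obtain ⟨t', s', h1, h2, h3⟩ := ih τ₁ t₁ r₁ ht₁0 (by push_cast at htn; linarith) ht₁t₀ hτ'r hτt
    have aτ := τ_bounds t τ ht htt₀ hτ
    have aτ₁ := τ_bounds t₁ τ₁ ht₁0 ht₁t₀ hτt
    refine ⟨t', s', ?_, h2, ?_⟩
    · have h4 := abs_add_le (t' - (τ₁ + t₁)) (τ₁ + t₁ - (τ + t))
      rw [sub_add_sub_cancel] at h4
      linarith
    · have at₁ : |t₁| ≤ t₀ := by rwa [abs_of_nonneg ht₁0]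
      have ar : |r| ≤ 2 * t₀ := by rw [abs_le]; constructor <;> linarith
      have ar₁ : |r₁| ≤ 2 * t₀ := by rw [abs_le]; constructor <;> linarith
      have ara : |r + a * r ^ 2| ≤ 2 * t₀ := by rw [abs_le]; constructor <;> linarith
      have atr' : |t| ≤ t₀ := by rwa [abs_of_nonneg ht]
      have f1 : F x r = F z t := by
        rw [hx, hF.add z hzR _ _ (by linarith) (by rw [sub_add_cancel]; linarith), sub_add_cancel]
      have f2 : F x (c * r ^ 2) = F z t₁ := by
        rw [hx, hF.add z hzR _ _ (by linarith) (by rw [← ht₁]; linarith)]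
      have d1 := hswap r hr0 (by linarith) x hxR
      rw [← ha_def, ← hb_def, ← hc_def, f1, f2, ← hr₁] at d1
      have m1 : dist (F z t) x₀ ≤ R / 2 + L * t₀ :=
        hF.dist_base_le hz.le (by linarith) atr' (by linarith)
      have m2 : dist (G (F z t) r) x₀ ≤ R / 2 + L * t₀ + L * (2 * t₀) :=
        hG.dist_base_le m1 (by linarith) ar (by linarith)
      have m3 : dist (F z t₁) x₀ ≤ R / 2 + L * t₀ :=
        hF.dist_base_le hz.le (by linarith) at₁ (by linarith)
      have m4 : dist (G (F z t₁) r₁) x₀ ≤ R / 2 + L * t₀ + L * (2 * t₀) :=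
        hG.dist_base_le m3 (by linarith) ar₁ (by linarith)
      have m5 : dist (F (G (F z t₁) r₁) (r + a * r ^ 2)) x₀ ≤
          R / 2 + L * t₀ + L * (2 * t₀) + L * (2 * t₀) :=
        hF.dist_base_le m4 (by linarith) ara (by linarith)
      have d2 := hF.lip_space (G (F z t) r) (by rw [mem_ball]; linarith)
        (F (G (F z t₁) r₁) (r + a * r ^ 2)) (by rw [mem_ball]; linarith) τ (by linarith)
      rw [hF.add (G (F z t₁) r₁) (by rw [mem_ball]; linarith) _ τ (by linarith)
        (by rw [← hτ₁]; linarith), ← hτ₁] at d2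
      have d3 := dist_triangle (F (G (F z t) r) τ) (F (G (F z t₁) r₁) τ₁) (F (G z s') t')
      have d4 : ε * r ^ 2 ≤ ε * (4 * s * (t - t₁)) := by gcongr
      linarith

/-- Displacing the endpoint of an `F`-curve from `z` along `G` for a short time `s` amounts, up to
`o(s)`, to displacing `z` along `G` and adjusting the time along `F`, both by `O(s)`. -/
def Transports (F G : M → ℝ → M) (x₀ : M) (ρ : ℝ) : Prop :=
  ∀ ε > 0, ∃ δ > 0, ∀ z ∈ ball x₀ ρ, ∀ t s, 0 ≤ t → t ≤ ρ → 0 < s → s < δ →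
    ∃ t' s', |t' - t| ≤ 2 * s ∧ |s'| ≤ 2 * s ∧ dist (G (F z t) s) (F (G z s') t') ≤ ε * s

theorem Transports.mono {ρ ρ' : ℝ} (h : Transports F G x₀ ρ) (hρ : ρ' ≤ ρ) :
    Transports F G x₀ ρ' := fun ε hε =>
  let ⟨δ, hδ, H⟩ := h ε hε
  ⟨δ, hδ, fun z hz t s ht htρ => H z (ball_subset_ball hρ hz) t s ht (htρ.trans hρ)⟩

theorem SwapApprox.exists_transports (hF : LocalFlow F x₀ R T L) (hG : LocalFlow G x₀ R T L)
    (hα : ∀ x ∈ ball x₀ R, |α x| ≤ A) (hβ : ∀ x ∈ ball x₀ R, |β x| ≤ A)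
    (hγ : ∀ x ∈ ball x₀ R, |γ x| ≤ A) (hcl : QuadClose F G x₀ R T C) (hC : 0 ≤ C)
    (h : SwapApprox F G x₀ R α β γ) : ∃ ρ > 0, Transports F G x₀ ρ := by
  have hL := hF.const_pos
  have hR := hF.radius_pos
  have hT := hF.time_pos
  obtain ⟨t₀, ht₀, ⟨⟨hAt₀, ht₀T⟩, ht₀R⟩, ht₀1⟩ : ∃ t₀ > 0, ((8 * A * t₀ < 1 ∧ 8 * t₀ < T) ∧
      32 * L * t₀ < R) ∧ 1 * t₀ < 1 := by
    obtain ⟨t₀, h1, h2⟩ := ((((eventually_const_mul_lt (8 * A) one_pos).and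
      (eventually_const_mul_lt 8 hT)).and (eventually_const_mul_lt (32 * L) hR)).and
      (eventually_const_mul_lt 1 one_pos)).and self_mem_nhdsWithin |>.exists
    exact ⟨t₀, h2, h1⟩
  refine ⟨min t₀ (R / 2), by positivity, fun ε hε => ?_⟩
  have H := h (ε / 16) (by linarith)
  obtain ⟨δ₁, hδ₁, H⟩ := eventually_nhdsGT_zero_iff.1 H
  obtain ⟨δ₂, hδ₂, H₂⟩ := eventually_nhdsGT_zero_iff.1
    (eventually_const_mul_lt (72 * C) (by linarith : 0 < ε / 2))
  refine ⟨min (min (δ₁ / 2) δ₂) t₀, by positivity, fun z hz t s ht htρ hs hsδ => ?_⟩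
  rw [lt_min_iff, lt_min_iff] at hsδ
  have htt₀ : t ≤ t₀ := htρ.trans (min_le_left _ _)
  have hA : 0 ≤ A := (abs_nonneg _).trans (hα x₀ (mem_ball_self hR))
  have hnn : 0 ≤ A * s * (t₀ - t) := mul_nonneg (mul_nonneg hA hs.le) (by linarith)
  obtain ⟨n, hn⟩ := exists_nat_ge (t / (s / 4))
  rw [div_le_iff₀ (by linarith)] at hn
  obtain ⟨t', s', h1, h2, h3⟩ := SwapApprox.transport_step hF hG hα hβ hγ hcl hC hs hsδ.2.le
    hAt₀.le ht₀T.le ht₀R.le (by linarith : 0 ≤ ε / 16)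
    (fun r hr0 hr x hx => H r hr0 (by linarith) x hx)
    (ball_subset_ball (min_le_right _ _) hz) n 0 t s ht hn htt₀
    (by simp only [sub_self, abs_zero]; linarith)
    (by rw [zero_add, abs_of_nonneg ht]; linarith)
  rw [zero_add] at h1
  rw [hF.zero] at h3
  refine ⟨t', s', ?_, h2, h3.trans ?_⟩
  · have : 8 * A * t₀ * s ≤ 1 * s := by gcongr
    have : 8 * A * s * t ≤ 8 * A * s * t₀ := by gcongr
    linarith
  · have e1 : ε / 16 * s * t ≤ ε / 16 * s * 1 := by
      gcongr
      linarith
    have e2 := H₂ s hs hsδ.1.2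
    have e3 : 72 * C * s * s ≤ ε / 2 * s := by gcongr
    linarith

end Transport

end

section

open Filter Topology

section TwoSided

variable {F G : M → ℝ → M} {x₀ : M} {R T L K C : ℝ} {α β γ : M → ℝ}

theorem SwapApprox.mono {R' : ℝ} (h : SwapApprox F G x₀ R α β γ) (hR : R' ≤ R) :
    SwapApprox F G x₀ R' α β γ := fun ε hε =>
  (h ε hε).mono fun _ hr x hx => hr x (ball_subset_ball hR hx)

/-- `Transports` for times of arbitrary sign. -/
def TransportsTwoSided (F G : M → ℝ → M) (x₀ : M) (ρ : ℝ) : Prop :=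
  ∀ ε > 0, ∃ δ > 0, ∀ z ∈ ball x₀ ρ, ∀ t s, |t| ≤ ρ → |s| < δ →
    ∃ t' s', |t' - t| ≤ 2 * |s| ∧ |s'| ≤ 2 * |s| ∧
      dist (G (F z t) s) (F (G z s') t') ≤ ε * |s|

theorem Transports.twoSided {ρ : ℝ} (hG0 : ∀ x, G x 0 = x) (h₁ : Transports F G x₀ ρ)
    (h₂ : Transports F (timeReverse G) x₀ ρ) (h₃ : Transports (timeReverse F) G x₀ ρ)
    (h₄ : Transports (timeReverse F) (timeReverse G) x₀ ρ) : TransportsTwoSided F G x₀ ρ := by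
  intro ε hε
  obtain ⟨δ₁, hδ₁, H₁⟩ := h₁ ε hε
  obtain ⟨δ₂, hδ₂, H₂⟩ := h₂ ε hε
  obtain ⟨δ₃, hδ₃, H₃⟩ := h₃ ε hε
  obtain ⟨δ₄, hδ₄, H₄⟩ := h₄ ε hε
  refine ⟨min (min δ₁ δ₂) (min δ₃ δ₄), by positivity, fun z hz t s ht hs => ?_⟩
  simp only [lt_min_iff] at hs
  obtain ⟨⟨hs₁, hs₂⟩, hs₃, hs₄⟩ := hs
  have flip : ∀ u v : ℝ, |-u - v| = |u - -v| := fun u v => by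
    rw [← abs_neg]
    congr 1
    ring
  rcases le_total 0 t with ht0 | ht0 <;> rcases lt_trichotomy s 0 with hs0 | rfl | hs0
  · rw [abs_of_neg hs0] at *
    rw [abs_of_nonneg ht0] at ht
    obtain ⟨t', s', h1, h2, h3⟩ := H₂ z hz t (-s) ht0 ht (by linarith) hs₂
    refine ⟨t', -s', h1, by rwa [abs_neg], ?_⟩
    simpa [timeReverse] using h3
  · exact ⟨t, 0, by simp, by simp, by simp [hG0]⟩
  · rw [abs_of_pos hs0] at *
    rw [abs_of_nonneg ht0] at ht
    exact H₁ z hz t s ht0 ht hs0 hs₁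
  · rw [abs_of_neg hs0] at *
    rw [abs_of_nonpos ht0] at ht
    obtain ⟨t', s', h1, h2, h3⟩ := H₄ z hz (-t) (-s) (by linarith) ht (by linarith) hs₄
    refine ⟨-t', -s', by rwa [flip], by rwa [abs_neg], ?_⟩
    simpa [timeReverse] using h3
  · exact ⟨t, 0, by simp, by simp, by simp [hG0]⟩
  · rw [abs_of_pos hs0] at *
    rw [abs_of_nonpos ht0] at ht
    obtain ⟨t', s', h1, h2, h3⟩ := H₃ z hz (-t) s (by linarith) ht hs0 hs₃
    refine ⟨-t', s', by rwa [flip], h2, ?_⟩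
    simpa [timeReverse] using h3

theorem SwapApprox.exists_transportsTwoSided (hF : LocalFlow F x₀ R T L)
    (hG : LocalFlow G x₀ R T L) (hα : BddLipOn α x₀ R K) (hβ : BddLipOn β x₀ R K)
    (hγ : BddLipOn γ x₀ R K) (hcl : QuadClose F G x₀ R T C) (hC : 0 ≤ C)
    (h : SwapApprox F G x₀ R α β γ) : ∃ ρ > 0, TransportsTwoSided F G x₀ ρ := by
  have hR := hF.radius_pos
  have hT := hF.time_pos
  have hK : 0 ≤ K := (abs_nonneg _).trans (hα.bound x₀ (mem_ball_self hR))
  have hR2 : R / 2 ≤ R := by linarith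
  have hR4 : R / 2 / 2 ≤ R := by linarith
  have hF₂ := hF.mono (half_pos hR) hT hR2 le_rfl le_rfl
  have hG₂ := hG.mono (half_pos hR) hT hR2 le_rfl le_rfl
  have hF₄ := hF.mono (half_pos (half_pos hR)) hT hR4 le_rfl le_rfl
  have hG₄ := hG.mono (half_pos (half_pos hR)) hT hR4 le_rfl le_rfl
  have hα' := (hα.add hβ.neg).mono hR2 le_rfl
  have hβ' := hβ.neg.mono hR2 (by linarith : K ≤ K + K)
  have hγ' := (hβ.add hγ).mono hR2 le_rfl
  have hl := SwapApprox.reverse_left hF hG hα hβ hγ h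
  obtain ⟨ρ₁, hρ₁, T₁⟩ := SwapApprox.exists_transports hF hG hα.bound hβ.bound hγ.bound hcl hC h
  obtain ⟨ρ₂, hρ₂, T₂⟩ := SwapApprox.exists_transports hF₂ hG₂.timeReverse
    (hγ.neg.mono hR2 le_rfl).bound (hβ.mono hR2 le_rfl).bound (hα.neg.mono hR2 le_rfl).bound
    (hcl.mono hR2 le_rfl).reverse_right hC (SwapApprox.reverse_right hF hG hα hβ hγ h)
  obtain ⟨ρ₃, hρ₃, T₃⟩ := SwapApprox.exists_transports hF₂.timeReverse hG₂ hα'.bound hβ'.bound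
    hγ'.bound (hcl.mono hR2 le_rfl).reverse_left hC hl
  have hr2 : R / 2 / 2 ≤ R / 2 := by linarith
  obtain ⟨ρ₄, hρ₄, T₄⟩ := SwapApprox.exists_transports hF₄.timeReverse hG₄.timeReverse
    (hγ'.neg.mono hr2 le_rfl).bound (hβ'.mono hr2 le_rfl).bound (hα'.neg.mono hr2 le_rfl).bound
    (hcl.mono hR4 le_rfl).reverse_left.reverse_right hC
    (SwapApprox.reverse_right hF₂.timeReverse hG₂ hα' hβ' hγ' hl)
  refine ⟨min (min ρ₁ ρ₂) (min ρ₃ ρ₄), by positivity, Transports.twoSided hG.zero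
    (T₁.mono ((min_le_left _ _).trans (min_le_left _ _)))
    (T₂.mono ((min_le_left _ _).trans (min_le_right _ _)))
    (T₃.mono ((min_le_right _ _).trans (min_le_left _ _)))
    (T₄.mono ((min_le_right _ _).trans (min_le_right _ _)))⟩

end TwoSided

section Flows

variable {X Y F G : M → ℝ → M} {x₀ : M} {R T L K : ℝ}

theorem Close.exists_quadClose (h : Close X Y) (hF : LocalFlow F x₀ R T L)
    (hG : LocalFlow G x₀ R T L)
    (hFX : ∀ x ∈ ball x₀ R, ∀ t, |t| ≤ T → dist (F x t) (X x t) ≤ L * t ^ 2)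
    (hGY : ∀ x ∈ ball x₀ R, ∀ t, |t| ≤ T → dist (G x t) (Y x t) ≤ L * t ^ 2) :
    ∃ R' > 0, ∃ T' > 0, ∃ C ≥ 0, QuadClose F G x₀ R' T' C := by
  obtain ⟨C, hC, r, hr, δ, hδ, H⟩ := h x₀
  have hL := hF.const_pos
  have hR := hF.radius_pos
  have hT := hF.time_pos
  obtain ⟨t₀, ⟨⟨⟨h1, h2⟩, h3⟩, h4⟩, ht₀⟩ : ∃ t₀, (((1 * t₀ < δ ∧ 1 * t₀ < T) ∧ 2 * L * t₀ < R) ∧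
      1 * t₀ < 1) ∧ t₀ ∈ Ioi (0 : ℝ) :=
    ((((eventually_const_mul_lt 1 hδ).and (eventually_const_mul_lt 1 hT)).and
      (eventually_const_mul_lt (2 * L) hR)).and (eventually_const_mul_lt 1 one_pos)).and
      self_mem_nhdsWithin |>.exists
  replace ht₀ : 0 < t₀ := ht₀
  rw [one_mul] at h1 h2 h4
  refine ⟨min r (R / 4), by positivity, min t₀ (R / (8 * L)), by positivity, C + 3 * L,
    by positivity, fun x hx s t hs ht => ?_⟩
  rw [le_min_iff] at hs ht
  have hx' : dist x x₀ < R / 4 := (mem_ball.1 hx).trans_le (min_le_right _ _)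
  have hxR : x ∈ ball x₀ R := by rw [mem_ball]; linarith
  have hs1 : |s| ≤ 1 := hs.1.trans h4.le
  have ht1 : |t| ≤ 1 := ht.1.trans h4.le
  have hsT : |s| ≤ T := hs.1.trans h2.le
  have htT : |t| ≤ T := ht.1.trans h2.le
  have lin : ∀ u : ℝ, |u| ≤ R / (8 * L) → L * |u| ≤ R / 8 := fun u hu => by
    rw [le_div_iff₀ (by positivity)] at hu
    linarith
  have quad : ∀ u : ℝ, |u| ≤ 1 → L * u ^ 2 ≤ L * |u| := fun u hu => by
    have : u ^ 2 ≤ |u| := by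
      rw [← sq_abs, sq]
      exact mul_le_of_le_one_left (abs_nonneg _) hu
    gcongr
  have lt := lin t ht.2
  have ls := lin s hs.2
  have qt := quad t ht1
  have qs := quad s hs1
  have d1 := hFX x hxR t htT
  have d2 := hGY x hxR s hsT
  have e1 := hF.dist_self_le hxR htT
  have e2 := hG.dist_self_le hxR hsT
  have m1 : F x t ∈ ball x₀ R := by
    have := dist_triangle (F x t) x x₀
    rw [mem_ball]; linarith
  have m2 : G x s ∈ ball x₀ R := by
    have := dist_triangle (G x s) x x₀
    rw [mem_ball]; linarith
  have m3 : X x t ∈ ball x₀ R := by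
    have := dist_triangle (F x t) x x₀
    have := dist_triangle (X x t) (F x t) x₀
    rw [dist_comm (X x t) (F x t)] at this
    rw [mem_ball]; linarith
  have m4 : Y x s ∈ ball x₀ R := by
    have := dist_triangle (G x s) x x₀
    have := dist_triangle (Y x s) (G x s) x₀
    rw [dist_comm (Y x s) (G x s)] at this
    rw [mem_ball]; linarith
  have d3 := hG.lip_space _ m1 _ m3 s hsT
  have d4 := hGY _ m3 s hsT
  have d5 := hF.lip_space _ m2 _ m4 t htT
  have d6 := hFX _ m4 t htT
  have d7 := H x (ball_subset_ball (min_le_left _ _) hx) s t (hs.1.trans_lt h1) (ht.1.trans_lt h1)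
  have t1 := dist_triangle4 (G (F x t) s) (G (X x t) s) (Y (X x t) s) (X (Y x s) t)
  have t2 := dist_triangle4 (G (F x t) s) (X (Y x s) t) (F (Y x s) t) (F (G x s) t)
  rw [dist_comm (X (Y x s) t) (F (Y x s) t), dist_comm (F (Y x s) t) (F (G x s) t)] at t2
  have key : C * |s * t| + 3 * L * t ^ 2 + 3 * L * s ^ 2 ≤ (C + 3 * L) * (|s| + |t|) ^ 2 := by
    rw [abs_mul, ← sq_abs s, ← sq_abs t]
    have := abs_nonneg s
    have := abs_nonneg t
    have h5 : 0 ≤ C * (|s| ^ 2 + |t| ^ 2 + |s| * |t|) := by positivity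
    have h6 : 0 ≤ L * (|s| * |t|) := by positivity
    linarith
  linarith

/-- Transversality makes the parametrization `(s, t) ↦ F_t G_s x₀` bi-Lipschitz from below. -/
theorem Transverse.exists_le_dist (h : Transverse X Y) (hF : LocalFlow F x₀ R T L)
    (hG : LocalFlow G x₀ R T L)
    (hFX : ∀ x ∈ ball x₀ R, ∀ t, |t| ≤ T → dist (F x t) (X x t) ≤ L * t ^ 2)
    (hGY : ∀ x ∈ ball x₀ R, ∀ t, |t| ≤ T → dist (G x t) (Y x t) ≤ L * t ^ 2) :
    ∃ c > 0, ∃ η > 0, ∀ s t s' t' : ℝ, |s| ≤ η → |t| ≤ η → |s'| ≤ η → |t'| ≤ η →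
      c * (|s - s'| + |t - t'|) ≤ dist (F (G x₀ s) t) (F (G x₀ s') t') := by
  obtain ⟨δ, hδ, H⟩ := h x₀
  have hL := hF.const_pos
  have hR := hF.radius_pos
  have hT := hF.time_pos
  obtain ⟨η, ⟨⟨⟨⟨h1, h2⟩, h3⟩, h4⟩, h5⟩, hη⟩ : ∃ η, ((((4 * η < δ ∧ 4 * η < T) ∧ 4 * L * η < R) ∧
      L * η < δ) ∧ 4 * L * η < δ) ∧ η ∈ Ioi (0 : ℝ) :=
    (((((eventually_const_mul_lt 4 hδ).and (eventually_const_mul_lt 4 hT)).and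
      (eventually_const_mul_lt (4 * L) hR)).and (eventually_const_mul_lt L hδ)).and
      (eventually_const_mul_lt (4 * L) hδ)).and self_mem_nhdsWithin |>.exists
  replace hη : 0 < η := hη
  have hLη : 0 < L * η := by positivity
  refine ⟨δ / 4, by positivity, η, hη, fun s t s' t' hs ht hs' ht' => ?_⟩
  have hx0 : x₀ ∈ ball x₀ R := mem_ball_self hR
  have hd0 : dist x₀ x₀ ≤ 0 := (dist_self x₀).le
  have n1 : dist (G x₀ s) x₀ ≤ 0 + L * η := hG.dist_base_le hd0 hR hs (by linarith)
  have n2 : dist (G x₀ s') x₀ ≤ 0 + L * η := hG.dist_base_le hd0 hR hs' (by linarith)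
  have n3 : dist (F (G x₀ s) t) x₀ ≤ 0 + L * η + L * η :=
    hF.dist_base_le n1 (by linarith) ht (by linarith)
  have n4 : dist (F (G x₀ s') t') x₀ ≤ 0 + L * η + L * η :=
    hF.dist_base_le n2 (by linarith) ht' (by linarith)
  have hts : |t - t'| ≤ 2 * η := (abs_sub _ _).trans (by linarith)
  have hss : |s' - s| ≤ 2 * η := (abs_sub _ _).trans (by linarith)
  set x := G x₀ s with hx
  have m1 : x ∈ ball x₀ R := by rw [mem_ball]; linarith
  have m2 : G x₀ s' ∈ ball x₀ R := by rw [mem_ball]; linarith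
  have d1 := hF.lip_space (F x t) (by rw [mem_ball]; linarith) (F (G x₀ s') t')
    (by rw [mem_ball]; linarith) (-t') (by rw [abs_neg]; linarith)
  have hT0 : |(0 : ℝ)| ≤ T := by simpa using hT.le
  rw [hF.add x m1 _ _ (by linarith) (by rw [← sub_eq_add_neg]; linarith),
    hF.add _ m2 _ _ (by linarith) (by simpa using hT0), add_neg_cancel, hF.zero,
    ← sub_eq_add_neg] at d1
  have f1 : G x (s' - s) = G x₀ s' := by
    rw [hx, hG.add x₀ hx0 _ _ (by linarith) (by rw [add_sub_cancel]; linarith), add_sub_cancel]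
  have d2 := H x (by rw [mem_ball]; linarith) (t - t') (s' - s) (by linarith) (by linarith)
  have d3 := hFX x m1 (t - t') (by linarith)
  have d4 := hGY x m1 (s' - s) (by linarith)
  have quad : ∀ u : ℝ, |u| ≤ 2 * η → L * u ^ 2 ≤ δ / 2 * |u| := fun u hu => by
    have h6 : L * |u| ≤ L * (2 * η) := by gcongr
    have h7 : L * |u| ≤ δ / 2 := by linarith
    rw [← sq_abs u, sq, ← mul_assoc]
    gcongr
  have q1 := quad _ hts
  have q2 := quad _ hss
  have t1 := dist_triangle4 (X x (t - t')) (F x (t - t')) (G x (s' - s)) (Y x (s' - s))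
  rw [dist_comm (X x (t - t')) (F x (t - t')), f1] at t1
  rw [f1] at d4
  rw [abs_sub_comm s s']
  linarith

end Flows

end

section

open Filter Topology

section Surface

variable {X Y F G : M → ℝ → M} {x₀ : M} {R T L K ρ c δ : ℝ} {a b : M → ℝ}

theorem nonempty_chartedSpace_of_homeomorph_square {S : Set M} (hS : S.Nonempty)
    (e : (Ioo (-δ) δ ×ˢ Ioo (-δ) δ : Set (ℝ × ℝ)) ≃ₜ S) :
    Nonempty (ChartedSpace (EuclideanSpace ℝ (Fin 2)) S) := by
  have := hS.to_subtype
  have h1 : IsOpenEmbedding ((↑) : (Ioo (-δ) δ ×ˢ Ioo (-δ) δ : Set (ℝ × ℝ)) → ℝ × ℝ) :=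
    (isOpen_Ioo.prod isOpen_Ioo).isOpenEmbedding_subtypeVal
  have h2 := (EuclideanSpace.equiv (Fin 2) ℝ).symm.toHomeomorph.isOpenEmbedding.comp
    (Homeomorph.finTwoArrow.symm.isOpenEmbedding.comp (h1.comp e.symm.isOpenEmbedding))
  exact ⟨h2.singletonChartedSpace⟩

theorem exists_homeomorph_squareSet (hF : LocalFlow F x₀ R T L) (hG : LocalFlow G x₀ R T L)
    (hδT : δ ≤ T) (hδR : L * δ < R) (hc : 0 < c)
    (hlow : ∀ s t s' t' : ℝ, |s| ≤ δ → |t| ≤ δ → |s'| ≤ δ → |t'| ≤ δ →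
      c * (|s - s'| + |t - t'|) ≤ dist (F (G x₀ s) t) (F (G x₀ s') t')) :
    ∃ e : (Ioo (-δ) δ ×ˢ Ioo (-δ) δ : Set (ℝ × ℝ)) ≃ₜ squareSet F G x₀ δ,
      ∀ p : (Ioo (-δ) δ ×ˢ Ioo (-δ) δ : Set (ℝ × ℝ)),
        (e p : M) = F (G x₀ (p : ℝ × ℝ).1) (p : ℝ × ℝ).2 := by
  have hL := hF.const_pos
  have hx0 : x₀ ∈ ball x₀ R := mem_ball_self hF.radius_pos
  set f : (Ioo (-δ) δ ×ˢ Ioo (-δ) δ : Set (ℝ × ℝ)) → M := fun p => F (G x₀ p.1.1) p.1.2 with hf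
  have bnd : ∀ p : (Ioo (-δ) δ ×ˢ Ioo (-δ) δ : Set (ℝ × ℝ)), |p.1.1| < δ ∧ |p.1.2| < δ :=
    fun p => ⟨abs_lt.2 p.2.1, abs_lt.2 p.2.2⟩
  have mem : ∀ s, |s| < δ → G x₀ s ∈ ball x₀ R := fun s hs => by
    have := hG.dist_base_le (dist_self x₀).le hF.radius_pos hs.le hδT
    rw [mem_ball]
    linarith
  have hlip : LipschitzWith (Real.toNNReal (3 * L)) f := by
    refine LipschitzWith.of_dist_le_mul fun p q => ?_
    rw [Real.coe_toNNReal _ (by positivity), Subtype.dist_eq, Prod.dist_eq, Real.dist_eq,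
      Real.dist_eq]
    obtain ⟨hp1, hp2⟩ := bnd p
    obtain ⟨hq1, hq2⟩ := bnd q
    have d1 := hF.lip_time _ (mem _ hp1) _ _ (hp2.le.trans hδT) (hq2.le.trans hδT)
    have d2 := hG.lip_time x₀ hx0 _ _ (hp1.le.trans hδT) (hq1.le.trans hδT)
    have d3 := hF.lip_space _ (mem _ hp1) _ (mem _ hq1) _ (hq2.le.trans hδT)
    have d4 := dist_triangle (F (G x₀ p.1.1) p.1.2) (F (G x₀ p.1.1) q.1.2) (F (G x₀ q.1.1) q.1.2)
    have d5 : L * |p.1.1 - q.1.1| ≤ L * max |p.1.1 - q.1.1| |p.1.2 - q.1.2| := by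
      gcongr
      exact le_max_left _ _
    have d6 : L * |p.1.2 - q.1.2| ≤ L * max |p.1.1 - q.1.1| |p.1.2 - q.1.2| := by
      gcongr
      exact le_max_right _ _
    simp only [hf]
    linarith
  have hanti : AntilipschitzWith (Real.toNNReal c⁻¹) f := by
    refine AntilipschitzWith.of_le_mul_dist fun p q => ?_
    rw [Real.coe_toNNReal _ (by positivity), Subtype.dist_eq, Prod.dist_eq, Real.dist_eq,
      Real.dist_eq, inv_mul_eq_div, le_div_iff₀ hc, mul_comm]
    obtain ⟨hp1, hp2⟩ := bnd p
    obtain ⟨hq1, hq2⟩ := bnd q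
    refine le_trans ?_ (hlow _ _ _ _ hp1.le hp2.le hq1.le hq2.le)
    gcongr
    exact max_le_add_of_nonneg (abs_nonneg _) (abs_nonneg _)
  have hemb := (hanti.isUniformEmbedding hlip.uniformContinuous).isEmbedding
  have hrange : range f = squareSet F G x₀ δ := by
    ext y
    constructor
    · rintro ⟨p, rfl⟩
      exact ⟨p.1.1, p.1.2, (bnd p).1, (bnd p).2, rfl⟩
    · rintro ⟨s, t, hs, ht, rfl⟩
      exact ⟨⟨(s, t), abs_lt.1 hs, abs_lt.1 ht⟩, rfl⟩
  exact ⟨hemb.toHomeomorph.trans (Homeomorph.setCongr hrange), fun p => rfl⟩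

theorem squareSet.setTangentTo (hF : LocalFlow F x₀ R T L) (hG : LocalFlow G x₀ R T L)
    (hFX : ∀ x ∈ ball x₀ R, ∀ t, |t| ≤ T → dist (F x t) (X x t) ≤ L * t ^ 2)
    (hGY : ∀ x ∈ ball x₀ R, ∀ t, |t| ≤ T → dist (G x t) (Y x t) ≤ L * t ^ 2)
    (htr : TransportsTwoSided F G x₀ ρ)
    (hδT : 2 * δ ≤ T) (hδR : 4 * L * δ ≤ R) (hδρ : 2 * δ ≤ ρ) (hδρ' : 2 * L * δ ≤ ρ) (hc : 0 < c)
    (hlow : ∀ s t s' t' : ℝ, |s| ≤ δ → |t| ≤ δ → |s'| ≤ δ → |t'| ≤ δ →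
      c * (|s - s'| + |t - t'|) ≤ dist (F (G x₀ s) t) (F (G x₀ s') t'))
    (ha : BddLipOn a x₀ R K) (hb : BddLipOn b x₀ R K) (hK : 0 < K) :
    SetTangentTo (squareSet F G x₀ δ) (sumArc (smulArc a X) (smulArc b Y)) := by
  have hL := hF.const_pos
  have hR := hF.radius_pos
  have hx0 : x₀ ∈ ball x₀ R := mem_ball_self hR
  rintro _ ⟨s₀, t₀, hs₀, ht₀, rfl⟩
  have hδ : 0 < δ := (abs_nonneg _).trans_lt hs₀
  have hLδ : 0 < L * δ := by positivity
  set η := min (δ - |s₀|) (δ - |t₀|) with hη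
  have hη0 : 0 < η := lt_min (by linarith) (by linarith)
  have hηs : η ≤ δ - |s₀| := min_le_left _ _
  have hηt : η ≤ δ - |t₀| := min_le_right _ _
  refine ⟨c * (η / 2), by positivity, fun ε hε => ?_⟩
  obtain ⟨δ₁, hδ₁, htr⟩ := htr (ε / (2 * K)) (by positivity)
  have ev := (((((eventually_const_mul_lt K hδ₁).and
    (eventually_const_mul_lt (6 * K) hη0)).and (eventually_const_mul_lt K one_pos)).and
    (eventually_const_mul_lt K hδ)).and
    (eventually_const_mul_lt (2 * L * K) (by linarith : 0 < R / 2))).and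
    (eventually_const_mul_lt (3 * L * K ^ 2 + 2 * L ^ 2 * K ^ 2) (by linarith : 0 < ε / 2))
  obtain ⟨d, hd, H⟩ := eventually_nhdsGT_zero_iff.1 ev
  refine ⟨d, hd, ?_⟩
  rintro _ ⟨⟨s, t, hs, ht, rfl⟩, hball⟩ h hh0 hhd
  obtain ⟨⟨⟨⟨⟨h1, h2⟩, h3⟩, h4⟩, h5⟩, h6⟩ := H |h| hh0 hhd
  have hst : |s - s₀| + |t - t₀| < η / 2 :=
    lt_of_mul_lt_mul_left ((hlow s t s₀ t₀ hs.le ht.le hs₀.le ht₀.le).trans_lt hball) hc.le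
  have hs' : |s| < δ - η / 2 := by
    have := abs_add_le (s - s₀) s₀
    rw [sub_add_cancel] at this
    linarith [abs_nonneg (t - t₀)]
  have ht' : |t| < δ - η / 2 := by
    have := abs_add_le (t - t₀) t₀
    rw [sub_add_cancel] at this
    linarith [abs_nonneg (s - s₀)]
  have m1 : dist (G x₀ s) x₀ ≤ 0 + L * δ :=
    hG.dist_base_le (dist_self x₀).le hR hs.le (by linarith)
  have m2 : dist (F (G x₀ s) t) x₀ ≤ 0 + L * δ + L * δ :=
    hF.dist_base_le m1 (by linarith) ht.le (by linarith)
  set z := G x₀ s with hz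
  set y := F z t with hy
  have hzR : z ∈ ball x₀ R := by rw [mem_ball]; linarith
  have hyR : y ∈ ball x₀ R := by rw [mem_ball]; linarith
  have e1 := hF.dist_linComb_le hG hFX hGY ha hb (x := y) (h := h) (by linarith) h3.le
    (by linarith)
  have small : ∀ k, |k| ≤ K → |k * h| ≤ K * |h| := fun k hk => by
    rw [abs_mul]
    gcongr
  have hp := small _ (ha.bound y hyR)
  have hq := small _ (hb.bound y hyR)
  set p := a y * h with hp_def
  set q := b y * h with hq_def
  have htp : |t + p| ≤ 2 * δ := (abs_add_le _ _).trans (by linarith)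
  have f1 : F y p = F z (t + p) := by
    rw [hy, hF.add z hzR _ _ (by linarith) (by linarith)]
  rw [f1] at e1
  obtain ⟨t', s', g1, g2, g3⟩ := htr z (by rw [mem_ball]; linarith) (t + p) q (by linarith)
    (by linarith)
  have bs : |s + s'| < δ := (abs_add_le _ _).trans_lt (by linarith)
  have bt : |t'| < δ := by
    have k1 := abs_add_le (t' - (t + p)) (t + p)
    rw [sub_add_cancel] at k1
    have k2 := abs_add_le t p
    linarith
  have f2 : G z s' = G x₀ (s + s') := by
    rw [hz, hG.add x₀ hx0 _ _ (by linarith) (by linarith)]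
  rw [f2] at g3
  have hmem : F (G x₀ (s + s')) t' ∈ squareSet F G x₀ δ := ⟨_, _, bs, bt, rfl⟩
  refine (infDist_le_dist_of_mem hmem).trans ?_
  have k1 : ε / (2 * K) * |q| ≤ ε / 2 * |h| := by
    calc ε / (2 * K) * |q| ≤ ε / (2 * K) * (K * |h|) := by gcongr
      _ = ε / 2 * |h| := by field_simp
  have k2 : (3 * L * K ^ 2 + 2 * L ^ 2 * K ^ 2) * h ^ 2 ≤ ε / 2 * |h| := by
    rw [← sq_abs h, sq |h|, ← mul_assoc]
    gcongr
  have := dist_triangle (sumArc (smulArc a X) (smulArc b Y) y h) (G (F z (t + p)) q)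
    (F (G x₀ (s + s')) t')
  linarith

end Surface

theorem exists_common_localFlow (hM : LocallyComplete M) {X Y F G : M → ℝ → M} {IX IY : M → Set ℝ}
    (hF : IsMaximalFlow X IX F) (hG : IsMaximalFlow Y IY G) (hX : IsArcField X) (hY : IsArcField Y)
    (hX1 : CondE1 X) (hX2 : CondE2 X) (hY1 : CondE1 Y) (hY2 : CondE2 Y) (x₀ : M) :
    ∃ R T L, LocalFlow F x₀ R T L ∧ LocalFlow G x₀ R T L ∧
      (∀ x ∈ ball x₀ R, ∀ t, |t| ≤ T → t ∈ IX x) ∧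
      (∀ x ∈ ball x₀ R, ∀ t, |t| ≤ T → t ∈ IY x) ∧
      (∀ x ∈ ball x₀ R, ∀ t, |t| ≤ T → dist (F x t) (X x t) ≤ L * t ^ 2) ∧
      (∀ x ∈ ball x₀ R, ∀ t, |t| ≤ T → dist (G x t) (Y x t) ≤ L * t ^ 2) := by
  obtain ⟨R₁, T₁, L₁, h₁, hI₁, hd₁⟩ := hF.exists_localFlow hM hX hX1 hX2 x₀
  obtain ⟨R₂, T₂, L₂, h₂, hI₂, hd₂⟩ := hG.exists_localFlow hM hY hY1 hY2 x₀
  have hR := lt_min h₁.radius_pos h₂.radius_pos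
  have hT := lt_min h₁.time_pos h₂.time_pos
  refine ⟨min R₁ R₂, min T₁ T₂, max L₁ L₂,
    h₁.mono hR hT (min_le_left _ _) (min_le_left _ _) (le_max_left _ _),
    h₂.mono hR hT (min_le_right _ _) (min_le_right _ _) (le_max_right _ _),
    fun x hx t ht => hI₁ x (ball_subset_ball (min_le_left _ _) hx) t (ht.trans (min_le_left _ _)),
    fun x hx t ht => hI₂ x (ball_subset_ball (min_le_right _ _) hx) t
      (ht.trans (min_le_right _ _)),
    fun x hx t ht => (hd₁ x (ball_subset_ball (min_le_left _ _) hx) t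
      (ht.trans (min_le_left _ _))).trans ?_,
    fun x hx t ht => (hd₂ x (ball_subset_ball (min_le_right _ _) hx) t
      (ht.trans (min_le_right _ _))).trans ?_⟩
  · gcongr
    exact le_max_left _ _
  · gcongr
    exact le_max_right _ _

theorem FlowBracketTangent.exists_transportsTwoSided {X Y F G : M → ℝ → M} {IX IY : M → Set ℝ}
    {x₀ : M} {R T L : ℝ} {a b : M → ℝ} (hF : LocalFlow F x₀ R T L) (hG : LocalFlow G x₀ R T L)
    (hIX : ∀ x ∈ ball x₀ R, ∀ t, |t| ≤ T → t ∈ IX x)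
    (hIY : ∀ x ∈ ball x₀ R, ∀ t, |t| ≤ T → t ∈ IY x)
    (hFX : ∀ x ∈ ball x₀ R, ∀ t, |t| ≤ T → dist (F x t) (X x t) ≤ L * t ^ 2)
    (hGY : ∀ x ∈ ball x₀ R, ∀ t, |t| ≤ T → dist (G x t) (Y x t) ≤ L * t ^ 2)
    (hclose : Close X Y) (ha : ∃ K, LipschitzWith K a) (hb : ∃ K, LipschitzWith K b)
    (hbr : FlowBracketTangent F G IX IY (sumArc (smulArc a X) (smulArc b Y))) :
    ∃ ρ > 0, TransportsTwoSided F G x₀ ρ := by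
  obtain ⟨K₁, hK₁, ha⟩ := LipschitzWith.exists_bddLipOn ha x₀ R
  obtain ⟨K₂, hK₂, hb⟩ := LipschitzWith.exists_bddLipOn hb x₀ R
  have ha' := ha.mono le_rfl (le_add_of_nonneg_right hK₂.le)
  have hb' := hb.mono le_rfl (le_add_of_nonneg_left hK₁.le)
  obtain ⟨R₁, hR₁, hsw⟩ := hbr.swapApprox hF hG hIX hIY hFX hGY ha' hb'
  obtain ⟨R₂, hR₂, T₂, hT₂, C, hC, hcl⟩ := hclose.exists_quadClose hF hG hFX hGY
  have h0 : BddLipOn (fun _ : M => (0 : ℝ)) x₀ R (K₁ + K₂) :=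
    ⟨fun x _ => by rw [abs_zero]; positivity, fun x _ y _ => by
      rw [sub_self, abs_zero]; positivity⟩
  have hR := lt_min hF.radius_pos (lt_min hR₁ hR₂)
  have hT := lt_min hF.time_pos hT₂
  have l1 : min R (min R₁ R₂) ≤ R := min_le_left _ _
  exact SwapApprox.exists_transportsTwoSided
    (hF.mono hR hT l1 (min_le_left _ _) le_rfl) (hG.mono hR hT l1 (min_le_left _ _) le_rfl)
    (h0.mono l1 le_rfl) (hb'.mono l1 le_rfl) (ha'.mono l1 le_rfl)
    (hcl.mono ((min_le_right _ _).trans (min_le_right _ _)) (min_le_right _ _)) hC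
    (hsw.mono ((min_le_right _ _).trans (min_le_left _ _)))

end

/-- Local Frobenius theorem for metric spaces: if `X` and `Y`
close, are transverse, satisfy E1 and E2 on a locally complete metric space, and
the bracket of their local flows satisfies `[F,G] ∼ aX + bY` for some Lipschitz
`a`, `b`, then through every point there is an integral surface; for all
sufficiently small `δ > 0` the set `{F_t G_s x₀ : |s|,|t| < δ}` is such a surface,
homeomorphic to `(-δ,δ)²` via `(s,t) ↦ F_t G_s x₀`. -/
theorem local_frobenius
    {M : Type*} [MetricSpace M] (hM : LocallyComplete M) (X Y : M → ℝ → M)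
    (hX : IsArcField X) (hY : IsArcField Y) (hclose : Close X Y)
    (htrans : Transverse X Y)
    (hXE1 : CondE1 X) (hXE2 : CondE2 X) (hYE1 : CondE1 Y) (hYE2 : CondE2 Y)
    (IX IY : M → Set ℝ) (F G : M → ℝ → M)
    (hF : ∀ x : M, IsSolutionCurve X (IX x) (F x) x ∧
      ∀ (J : Set ℝ) (τ : ℝ → M), IsSolutionCurve X J τ x →
        J ⊆ IX x ∧ Set.EqOn τ (F x) J)
    (hG : ∀ x : M, IsSolutionCurve Y (IY x) (G x) x ∧
      ∀ (J : Set ℝ) (τ : ℝ → M), IsSolutionCurve Y J τ x →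
        J ⊆ IY x ∧ Set.EqOn τ (G x) J)
    (a b : M → ℝ) (ha : ∃ K, LipschitzWith K a) (hb : ∃ K, LipschitzWith K b)
    (hbr : FlowBracketTangent F G IX IY (sumArc (smulArc a X) (smulArc b Y))) :
    ∀ x₀ : M,
      (∃ S : Set M, x₀ ∈ S ∧ IsIntegralSurface X Y S) ∧
      ∃ δ₀ > (0 : ℝ), ∀ δ : ℝ, 0 < δ → δ ≤ δ₀ →
        x₀ ∈ squareSet F G x₀ δ ∧
        IsIntegralSurface X Y (squareSet F G x₀ δ) ∧
        ∃ e : (Set.Ioo (-δ) δ ×ˢ Set.Ioo (-δ) δ : Set (ℝ × ℝ)) ≃ₜ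
            (squareSet F G x₀ δ),
          ∀ p : (Set.Ioo (-δ) δ ×ˢ Set.Ioo (-δ) δ : Set (ℝ × ℝ)),
            (e p : M) = F (G x₀ (p : ℝ × ℝ).1) (p : ℝ × ℝ).2 := by
  intro x₀
  obtain ⟨R₀, T₀, L, hF₀, hG₀, hIX, hIY, hFX, hGY⟩ :=
    exists_common_localFlow hM hF hG hX hY hXE1 hXE2 hYE1 hYE2 x₀
  obtain ⟨c, hc, η, hη, hlow⟩ := htrans.exists_le_dist hF₀ hG₀ hFX hGY
  obtain ⟨ρ, hρ, htr⟩ := FlowBracketTangent.exists_transportsTwoSided hF₀ hG₀ hIX hIY hFX hGY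
    hclose ha hb hbr
  obtain ⟨δ₀, ⟨⟨⟨⟨h1, h2⟩, h3⟩, h4⟩, h5⟩, hδ₀⟩ := (((((eventually_const_mul_lt 1 hη).and
    (eventually_const_mul_lt 2 hF₀.time_pos)).and
    (eventually_const_mul_lt (4 * L) hF₀.radius_pos)).and (eventually_const_mul_lt 2 hρ)).and
    (eventually_const_mul_lt (2 * L) hρ)).and self_mem_nhdsWithin |>.exists
  replace hδ₀ : 0 < δ₀ := hδ₀
  have main : ∀ δ : ℝ, 0 < δ → δ ≤ δ₀ →
      x₀ ∈ squareSet F G x₀ δ ∧ IsIntegralSurface X Y (squareSet F G x₀ δ) ∧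
      ∃ e : (Set.Ioo (-δ) δ ×ˢ Set.Ioo (-δ) δ : Set (ℝ × ℝ)) ≃ₜ (squareSet F G x₀ δ),
        ∀ p : (Set.Ioo (-δ) δ ×ˢ Set.Ioo (-δ) δ : Set (ℝ × ℝ)),
          (e p : M) = F (G x₀ (p : ℝ × ℝ).1) (p : ℝ × ℝ).2 := by
    intro δ hδ hδδ₀
    have hL := hF₀.const_pos
    have hLδ : L * δ ≤ L * δ₀ := by gcongr
    have hLδ0 : 0 < L * δ := by positivity
    have hlow' : ∀ s t s' t' : ℝ, |s| ≤ δ → |t| ≤ δ → |s'| ≤ δ → |t'| ≤ δ →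
        c * (|s - s'| + |t - t'|) ≤ dist (F (G x₀ s) t) (F (G x₀ s') t') :=
      fun s t s' t' hs ht hs' ht' => hlow s t s' t' (by linarith) (by linarith) (by linarith)
        (by linarith)
    have hmem : x₀ ∈ squareSet F G x₀ δ :=
      ⟨0, 0, by rwa [abs_zero], by rwa [abs_zero], by rw [hG₀.zero, hF₀.zero]⟩
    obtain ⟨e, he⟩ := exists_homeomorph_squareSet hF₀ hG₀ (by linarith) (by linarith) hc hlow'
    refine ⟨hmem, ⟨nonempty_chartedSpace_of_homeomorph_square ⟨x₀, hmem⟩ e, ?_⟩, e, he⟩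
    intro a' b' ha' hb'
    obtain ⟨K₁, hK₁, hbd₁⟩ := LipschitzWith.exists_bddLipOn ha' x₀ R₀
    obtain ⟨K₂, hK₂, hbd₂⟩ := LipschitzWith.exists_bddLipOn hb' x₀ R₀
    exact squareSet.setTangentTo hF₀ hG₀ hFX hGY htr (by linarith) (by linarith) (by linarith)
      (by linarith) hc hlow' (hbd₁.mono le_rfl (le_add_of_nonneg_right hK₂.le))
      (hbd₂.mono le_rfl (le_add_of_nonneg_left hK₁.le)) (by positivity)
  obtain ⟨hm, hS, -⟩ := main δ₀ hδ₀ le_rfl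
  exact ⟨⟨_, hm, hS⟩, δ₀, hδ₀, main⟩
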